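/- Fix a real ε with 0 < ε < 10⁻² and set κ = 1/2 − ε. Then there exists a threshold N₀ (depending only on ε) such that for every natural number N ≥ N₀ satisfying |N − R²| ≤ 4·e^{2(log N)^κ} for some R ∈ ℕ, the set {(m,n) ∈ ℤ² : m·n = N and |n − N^{1/2}| ≤ 2·N^{1/4}·(log N)^{κ/4}} has at most 10 elements. -/

import Mathlib

open Filter

/-- The divisor bound `d(n) ≤ C n ^ δ`. -/
theorem card_divisors_le_rpow (δ : ℝ) (hδ : 0 < δ) :
    ∃ C : ℝ, 1 ≤ C ∧ ∀ n : ℕ, n ≠ 0 → (n.divisors.card : ℝ) ≤ C * (n : ℝ) ^ δ := by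
  obtain ⟨P, hP⟩ := exists_nat_ge ((2 : ℝ) ^ (1 / δ))
  set c : ℝ := 1 + 1 / (δ * Real.log 2) with hc
  have hl2 : 0 < Real.log 2 := Real.log_pos one_lt_two
  have hc1 : 1 ≤ c := by
    have : 0 ≤ 1 / (δ * Real.log 2) := by positivity
    linarith
  refine ⟨c ^ P, one_le_pow₀ hc1, fun n hn => ?_⟩
  have hfac : (n : ℝ) ^ δ = ∏ p ∈ n.primeFactors, ((p : ℝ) ^ (n.factorization p)) ^ δ := by
    conv_lhs => rw [← Nat.prod_factorization_pow_eq_self hn]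
    rw [Finsupp.prod, Nat.cast_prod, ← Real.finsetProd_rpow]
    · simp
    · intros; positivity
  rw [Nat.card_divisors hn, Nat.cast_prod, hfac]
  have step : ∀ p ∈ n.primeFactors, ((n.factorization p + 1 : ℕ) : ℝ) ≤
      (if p < P then c else 1) * ((p : ℝ) ^ (n.factorization p)) ^ δ := by
    intro p hp
    have hp2 : (2 : ℝ) ≤ p := by exact_mod_cast (Nat.prime_of_mem_primeFactors hp).two_le
    set e := n.factorization p
    have hrw : ((p : ℝ) ^ e) ^ δ = ((p : ℝ) ^ δ) ^ e := by
      rw [← Real.rpow_natCast, ← Real.rpow_natCast, ← Real.rpow_mul (by linarith),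
        ← Real.rpow_mul (by linarith), mul_comm]
    split_ifs with h
    · have h1 : ((p : ℝ) ^ e) ^ δ ≥ Real.exp (δ * e * Real.log 2) := by
        rw [hrw]
        calc ((p : ℝ) ^ δ) ^ e ≥ ((2 : ℝ) ^ δ) ^ e := by gcongr
          _ = _ := by
            rw [← Real.rpow_natCast, ← Real.rpow_mul (by norm_num), Real.rpow_def_of_pos (by norm_num)]
            ring_nf
      have h2 := Real.add_one_le_exp (δ * e * Real.log 2)
      have h3 : ((e + 1 : ℕ) : ℝ) ≤ c * (δ * e * Real.log 2 + 1) := by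
        rw [hc]; push_cast
        have : (1 + 1 / (δ * Real.log 2)) * (δ * e * Real.log 2 + 1) =
          e + 1 + δ * e * Real.log 2 + 1 / (δ * Real.log 2) := by field_simp; ring
        rw [this]
        have : 0 ≤ δ * e * Real.log 2 := by positivity
        have : 0 ≤ 1 / (δ * Real.log 2) := by positivity
        linarith
      calc _ ≤ _ := h3
        _ ≤ _ := by gcongr; linarith
    · have hPp : (2 : ℝ) ^ (1 / δ) ≤ p := hP.trans (by exact_mod_cast not_lt.mp h)
      have : (2 : ℝ) ≤ (p : ℝ) ^ δ := by
        calc (2 : ℝ) = ((2 : ℝ) ^ (1 / δ)) ^ δ := by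
              rw [← Real.rpow_mul (by norm_num), one_div_mul_cancel hδ.ne', Real.rpow_one]
          _ ≤ _ := by gcongr
      rw [one_mul, hrw]
      calc ((e + 1 : ℕ) : ℝ) ≤ (2 : ℝ) ^ e := by exact_mod_cast Nat.lt_two_pow_self
        _ ≤ _ := by gcongr
  calc _ ≤ ∏ p ∈ n.primeFactors, (if p < P then c else 1) * ((p : ℝ) ^ (n.factorization p)) ^ δ :=
        Finset.prod_le_prod (fun _ _ => by positivity) step
    _ = (∏ p ∈ n.primeFactors, (if p < P then c else 1)) * _ := Finset.prod_mul_distrib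
    _ ≤ _ := by
      gcongr
      rw [Finset.prod_ite]
      simp only [Finset.prod_const, one_pow, mul_one]
      apply pow_le_pow_right₀ hc1
      calc _ ≤ (Finset.range P).card := Finset.card_le_card (by
            intro p hp; simp only [Finset.mem_filter] at hp; simpa using hp.2)
        _ = P := by simp

theorem coeff_prod_sum_of_natDegree_le {R ι : Type*} [CommSemiring R] (s : Finset ι)
    (f : ι → Polynomial R) (d : ι → ℕ) (h : ∀ i ∈ s, (f i).natDegree ≤ d i) :
    (∏ i ∈ s, f i).coeff (∑ i ∈ s, d i) = ∏ i ∈ s, (f i).coeff (d i) := by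
  classical
  induction s using Finset.induction_on with
  | empty => simp
  | insert a s ha ih =>
    rw [Finset.prod_insert ha, Finset.sum_insert ha, Finset.prod_insert ha,
      Polynomial.coeff_mul_add_eq_of_natDegree_le (h a (Finset.mem_insert_self a s)),
      ih fun i hi => h i (Finset.mem_insert_of_mem hi)]
    exact (Polynomial.natDegree_prod_le _ _).trans
      (Finset.sum_le_sum fun i hi => h i (Finset.mem_insert_of_mem hi))

theorem sum_subtype_eq_of_zero {ι M : Type*} [Fintype ι] [AddCommMonoid M] (f : ι → M)
    (p : ι → Prop) [DecidablePred p] (h : ∀ i, ¬ p i → f i = 0) :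
    ∑ i, f i = ∑ i : {i // p i}, f i := by
  rw [← Finset.sum_subtype (Finset.univ.filter p) (by simp) f]
  exact (Finset.sum_subset (Finset.filter_subset _ _) fun i _ hi => h i (by simpa using hi)).symm

/-- Zero estimate for two-variable exponential polynomials: too many zeros force all polynomial
coefficients to vanish. -/
theorem exp_poly_zero_estimate {K L I J q : ℕ} {w b : ℝ} (hw : 0 < w) (hw1 : w ≠ 1) (hb : 0 < b)
    (hK : 1 ≤ K) (hIq : I ≤ q) (hLI : L ≤ I) (hKL : K * L ≤ (I - L) * J)
    (P : Fin L → Polynomial ℝ) (hdeg : ∀ p, (P p).natDegree < K)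
    (hP : ∀ i < I, ∀ j < J, ∑ p : Fin L, (P p).eval ((i : ℝ) + j * q) * (w ^ i * b ^ j) ^ (p : ℕ) = 0) :
    ∀ p, P p = 0 := by
  classical
  by_contra hne
  push Not at hne
  let S := {p : Fin L // P p ≠ 0}
  let s := Fintype.card S
  have hs1 : 1 ≤ s := Fintype.card_pos_iff.mpr ⟨⟨hne.choose, hne.choose_spec⟩⟩
  have hsL : s ≤ L := by
    calc s ≤ Fintype.card (Fin L) := Fintype.card_subtype_le _
      _ = L := by simp
  let e : Fin s ≃ S := (Fintype.equivFin S).symm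
  let M : Matrix (Fin s) (Fin s) (Polynomial ℝ) := fun a t =>
    (P (e a).1).comp (Polynomial.X + Polynomial.C (t : ℝ)) * Polynomial.C ((w ^ ((e a).1 : ℕ)) ^ (t : ℕ))
  let D : Fin s → ℕ := fun a => (P (e a).1).natDegree
  have hMdeg : ∀ a t, (M a t).natDegree ≤ D a := by
    intro a t
    refine (Polynomial.natDegree_mul_C_le _ _).trans ?_
    rw [Polynomial.natDegree_comp, Polynomial.natDegree_X_add_C, mul_one]
  have hMcoeff : ∀ a t, (M a t).coeff (D a) = (P (e a).1).leadingCoeff * (w ^ ((e a).1 : ℕ)) ^ (t : ℕ) := by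
    intro a t
    simp only [M, D, Polynomial.coeff_mul_C]
    congr 1
    have h1 : ((P (e a).1).comp (Polynomial.X + Polynomial.C (t : ℝ))).natDegree = (P (e a).1).natDegree := by
      rw [Polynomial.natDegree_comp, Polynomial.natDegree_X_add_C, mul_one]
    conv_lhs => rw [← h1]
    rw [Polynomial.coeff_natDegree, Polynomial.leadingCoeff_comp (by rw [Polynomial.natDegree_X_add_C]; exact one_ne_zero),
      Polynomial.leadingCoeff_X_add_C, one_pow, mul_one]
  have hprod : ∀ (σ : Equiv.Perm (Fin s)), (∏ a, M a (σ a)).natDegree ≤ ∑ a, D a := fun σ =>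
    (Polynomial.natDegree_prod_le _ _).trans (Finset.sum_le_sum fun a _ => hMdeg a _)
  have hdet : M.det = ∑ σ : Equiv.Perm (Fin s), (Equiv.Perm.sign σ : ℤ) • ∏ a, M a (σ a) := by
    rw [← Matrix.det_transpose, Matrix.det_apply]; rfl
  have hcoeff : M.det.coeff (∑ a, D a) =
      (∏ a, (P (e a).1).leadingCoeff) * (Matrix.vandermonde fun a : Fin s => w ^ ((e a).1 : ℕ)).det := by
    rw [hdet, Polynomial.finsetSum_coeff, ← Matrix.det_transpose (Matrix.vandermonde _),
      Matrix.det_apply, Finset.mul_sum]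
    refine Finset.sum_congr rfl fun σ _ => ?_
    rw [Polynomial.coeff_smul, coeff_prod_sum_of_natDegree_le]
    · simp only [hMcoeff, Finset.prod_mul_distrib, Matrix.transpose_apply, Matrix.vandermonde_apply]
      simp [Units.smul_def]
      ring
    · intro a _; exact hMdeg _ _
  have hinj : Function.Injective fun a : Fin s => w ^ ((e a).1 : ℕ) := by
    intro a a' h
    have := pow_right_injective₀ hw hw1 h
    exact e.injective (Subtype.ext (Fin.ext this))
  have hdet0 : M.det ≠ 0 := by
    intro h
    rw [h, Polynomial.coeff_zero] at hcoeff
    have h2 := (Matrix.det_vandermonde_ne_zero_iff (v := fun a : Fin s => w ^ ((e a).1 : ℕ))).mpr hinj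
    have h3 : ∏ a, (P (e a).1).leadingCoeff ≠ 0 :=
      Finset.prod_ne_zero_iff.mpr fun a _ => Polynomial.leadingCoeff_ne_zero.mpr (e a).2
    exact (mul_ne_zero h3 h2) hcoeff.symm
  have hdetdeg : M.det.natDegree ≤ (K - 1) * L := by
    rw [hdet]
    refine Polynomial.natDegree_sum_le_of_forall_le _ _ fun σ _ => ?_
    refine (Polynomial.natDegree_smul_le _ _).trans ((hprod σ).trans ?_)
    calc ∑ a, D a ≤ ∑ a : Fin s, (K - 1) := Finset.sum_le_sum fun a _ => Nat.le_sub_one_of_lt (hdeg _)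
      _ = s * (K - 1) := by simp
      _ ≤ _ := by rw [mul_comm]; gcongr
  have hroot : ∀ i < I - L, ∀ j < J, M.det.IsRoot ((i : ℝ) + j * q) := by
    intro i hi j hj
    have : Polynomial.eval ((i : ℝ) + j * q) M.det = (M.map (Polynomial.eval ((i : ℝ) + j * q))).det := by
      rw [← Polynomial.coe_evalRingHom, RingHom.map_det]; rfl
    rw [Polynomial.IsRoot, this, ← Matrix.exists_vecMul_eq_zero_iff]
    refine ⟨fun a => (w ^ i * b ^ j) ^ ((e a).1 : ℕ), ?_, ?_⟩
    · intro h
      have := congrFun h ⟨0, hs1⟩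
      simp only [Pi.zero_apply] at this
      exact absurd this (by positivity)
    · ext t
      have h := hP (i + t) (by have := t.2; omega) j hj
      change ∑ a : Fin s, (w ^ i * b ^ j) ^ ((e a).1 : ℕ) *
        Polynomial.eval ((i : ℝ) + j * q) ((P (e a).1).comp (Polynomial.X + Polynomial.C (t : ℝ)) *
          Polynomial.C ((w ^ ((e a).1 : ℕ)) ^ (t : ℕ))) = 0
      rw [e.sum_comp fun p : S => (w ^ i * b ^ j) ^ (p.1 : ℕ) *
        Polynomial.eval ((i : ℝ) + j * q) ((P p.1).comp (Polynomial.X + Polynomial.C (t : ℝ)) *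
          Polynomial.C ((w ^ (p.1 : ℕ)) ^ (t : ℕ))), ← h]
      rw [← sum_subtype_eq_of_zero (fun p : Fin L => (w ^ i * b ^ j) ^ (p : ℕ) *
        Polynomial.eval ((i : ℝ) + j * q) ((P p).comp (Polynomial.X + Polynomial.C (t : ℝ)) *
          Polynomial.C ((w ^ (p : ℕ)) ^ (t : ℕ)))) (fun p => P p ≠ 0) (fun p hp => by
            simp [not_not.mp hp])]
      refine Finset.sum_congr rfl fun p _ => ?_
      rw [Polynomial.eval_mul, Polynomial.eval_comp, Polynomial.eval_C, Polynomial.eval_add,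
        Polynomial.eval_X, Polynomial.eval_C]
      push_cast
      rw [show (i : ℝ) + j * q + t = i + t + j * q by ring]
      ring
  have hcard : (I - L) * J ≤ (K - 1) * L := by
    let T : Finset ℝ := (Finset.range (I - L) ×ˢ Finset.range J).image fun x => (x.1 : ℝ) + x.2 * q
    have hT : T.card = (I - L) * J := by
      rw [Finset.card_image_of_injOn, Finset.card_product, Finset.card_range, Finset.card_range]
      rintro ⟨i, j⟩ hx ⟨i', j'⟩ hx' h
      simp only [Finset.coe_product, Finset.coe_range, Set.mem_prod, Set.mem_Iio] at hx hx'
      simp only at h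
      have h' : i + j * q = i' + j' * q := by exact_mod_cast h
      have h1 : i < q := by omega
      have h2 : i' < q := by omega
      have h3 : i = i' := by
        have := congrArg (· % q) h'
        simpa [Nat.add_mul_mod_self_right, Nat.mod_eq_of_lt h1, Nat.mod_eq_of_lt h2] using this
      subst h3
      have : j * q = j' * q := by omega
      rw [Nat.mul_right_cancel (by omega) this]
    rw [← hT]
    refine (Polynomial.card_le_degree_of_subset_roots (p := M.det) ?_).trans hdetdeg
    intro z hz
    obtain ⟨⟨i, j⟩, hx, rfl⟩ := Finset.mem_image.mp (Finset.mem_val.mp hz)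
    simp only [Finset.mem_product, Finset.mem_range] at hx
    exact (Polynomial.mem_roots hdet0).mpr (hroot i hx.1 j hx.2)
  obtain ⟨K, rfl⟩ := Nat.exists_eq_add_of_le hK
  have h4 : (1 + K) * L = L + K * L := by ring
  have h5 : (1 + K - 1) * L = K * L := by rw [Nat.add_sub_cancel_left]
  omega

theorem span_exp_poly_eq_top {K L I J q : ℕ} {w b : ℝ} (hw : 0 < w) (hw1 : w ≠ 1) (hb : 0 < b)
    (hK : 1 ≤ K) (hIq : I ≤ q) (hLI : L ≤ I) (hKL : K * L ≤ (I - L) * J) :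
    Submodule.span ℝ (Set.range fun (x : Fin I × Fin J) (y : Fin K × Fin L) =>
      ((x.1 : ℝ) + x.2 * q) ^ (y.1 : ℕ) * (w ^ (x.1 : ℕ) * b ^ (x.2 : ℕ)) ^ (y.2 : ℕ)) = ⊤ := by
  classical
  by_contra hne
  obtain ⟨f, hf0, hf⟩ := Submodule.exists_le_ker_of_lt_top _ (lt_top_iff_ne_top.mpr hne)
  let c : Fin K × Fin L → ℝ := fun y => f (Pi.single y 1)
  have hfc : ∀ v : Fin K × Fin L → ℝ, f v = ∑ y, v y * c y := by
    intro v
    conv_lhs => rw [pi_eq_sum_univ' v]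
    simp [c, map_sum]
  let P : Fin L → Polynomial ℝ := fun p => ∑ k : Fin K, Polynomial.monomial (k : ℕ) (c (k, p))
  have hdeg : ∀ p, (P p).natDegree < K := by
    intro p
    refine lt_of_le_of_lt (Polynomial.natDegree_sum_le_of_forall_le (n := K - 1) _ _ fun k _ => ?_) (by omega)
    exact (Polynomial.natDegree_monomial_le _).trans (Nat.le_sub_one_of_lt k.2)
  have hP := exp_poly_zero_estimate hw hw1 hb hK hIq hLI hKL P hdeg (by
    intro i hi j hj
    have h0 : f _ = 0 := hf (Submodule.subset_span (Set.mem_range_self (⟨i, hi⟩, ⟨j, hj⟩)))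
    rw [hfc, Fintype.sum_prod_type_right] at h0
    rw [← h0]
    refine Finset.sum_congr rfl fun p _ => ?_
    simp only [P, Polynomial.eval_finsetSum, Polynomial.eval_monomial, Finset.sum_mul]
    refine Finset.sum_congr rfl fun k _ => ?_
    ring)
  apply hf0
  ext y
  have hc : c y = 0 := by
    have h := congrArg (fun Q => Polynomial.coeff Q y.1) (hP y.2)
    simp only [P, Polynomial.finsetSum_coeff, Polynomial.coeff_monomial, Polynomial.coeff_zero] at h
    rw [Finset.sum_eq_single y.1] at h
    · simpa using h
    · intro k _ hk
      rw [if_neg]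
      exact fun h => hk (Fin.ext h)
    · simp
  simpa [c] using hc

theorem exists_auxiliary_coeffs {K L I J q M : ℕ} {w b : ℝ} (hw : 0 < w) (hw1 : w ≠ 1) (hb : 0 < b)
    (hK : 1 ≤ K) (hIq : I ≤ q) (hLI : L ≤ I) (hKL : K * L ≤ (I - L) * J)
    (hM : 1 ≤ M) (hMKL : M < K * L) :
    ∃ (κ : Type) (_ : Fintype κ) (x : κ → ℕ × ℕ) (a : κ → ℤ), Fintype.card κ = K * L ∧
      (∀ s, (x s).1 < I ∧ (x s).2 < J) ∧
      (∀ s, |(a s : ℝ)| ≤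
        ((K * L : ℝ) * (J * q : ℝ) ^ M) ^ ((M : ℝ) / ((K * L : ℝ) - M))) ∧
      (∀ m < M, ∑ s, (a s : ℝ) * (((x s).1 : ℝ) + (x s).2 * q) ^ m = 0) ∧
      ∃ k < K, ∃ p < L, ∑ s, (a s : ℝ) * ((((x s).1 : ℝ) + (x s).2 * q) ^ k *
        (w ^ (x s).1 * b ^ (x s).2) ^ p) ≠ 0 := by
  classical
  let v : Fin I × Fin J → Fin K × Fin L → ℝ := fun x y =>
      ((x.1 : ℝ) + x.2 * q) ^ (y.1 : ℕ) * (w ^ (x.1 : ℕ) * b ^ (x.2 : ℕ)) ^ (y.2 : ℕ)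
  obtain ⟨κ', e', he', hspan', hli'⟩ := exists_linearIndependent' ℝ v
  have : Finite κ' := Finite.of_injective e' he'
  obtain ⟨n, ⟨φ⟩⟩ := Finite.exists_equiv_fin κ'
  let κ := Fin n
  let e : κ → Fin I × Fin J := e' ∘ φ.symm
  have hli : LinearIndependent ℝ (v ∘ e) := hli'.comp φ.symm φ.symm.injective
  have hspan : Submodule.span ℝ (Set.range (v ∘ e)) = ⊤ := by
    have : Set.range (v ∘ e) = Set.range (v ∘ e') := by
      rw [show v ∘ e = (v ∘ e') ∘ φ.symm from rfl, φ.symm.surjective.range_comp]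
    rw [this, hspan']
    exact span_exp_poly_eq_top hw hw1 hb hK hIq hLI hKL
  have hcard : Fintype.card κ = K * L := by
    have := Module.finrank_eq_card_basis (Module.Basis.mk hli hspan.ge)
    simpa using this.symm
  let A : Matrix (Fin M) κ ℤ := fun m s => (((e s).1 : ℤ) + (e s).2 * q) ^ (m : ℕ)
  have hl : ∀ s, ((e s).1 : ℕ) + (e s).2 * q ≤ J * q := by
    intro s
    have h1 := (e s).1.2
    have h2 := (e s).2.2
    calc ((e s).1 : ℕ) + (e s).2 * q ≤ q + (e s).2 * q := by omega
      _ = ((e s).2 + 1) * q := by ring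
      _ ≤ _ := Nat.mul_le_mul_right _ h2
  have hJq : 1 ≤ J * q := by
    by_contra h
    have h0 : J * q = 0 := by omega
    rcases Nat.mul_eq_zero.mp h0 with h | h
    · subst h; omega
    · have : I - L = 0 := by omega
      rw [this] at hKL; omega
  let _ : SeminormedAddCommGroup (Matrix (Fin M) κ ℤ) := Matrix.seminormedAddCommGroup
  obtain ⟨t, ht0, hAt, htn⟩ := Int.Matrix.exists_ne_zero_int_vec_norm_le A (by rw [hcard, Fintype.card_fin]; exact hMKL)
    (by rw [Fintype.card_fin]; exact hM)
  refine ⟨κ, inferInstance, fun s => ((e s).1, (e s).2), t, hcard, fun s => ⟨(e s).1.2, (e s).2.2⟩,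
    fun s => ?_, fun m hm => ?_, ?_⟩
  · have hA : max 1 ‖A‖ ≤ (J * q : ℝ) ^ M := by
      have hJq' : (1 : ℝ) ≤ J * q := by exact_mod_cast hJq
      refine max_le (one_le_pow₀ hJq') ?_
      rw [Matrix.norm_le_iff (by positivity)]
      intro m s
      simp only [A]
      rw [Int.norm_eq_abs]
      push_cast
      rw [abs_of_nonneg (by positivity)]
      calc (((e s).1 : ℝ) + (e s).2 * q) ^ (m : ℕ) ≤ (J * q : ℝ) ^ (m : ℕ) := by
            gcongr; exact_mod_cast hl s
        _ ≤ _ := pow_le_pow_right₀ hJq' m.2.le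
    have h1 : |(t s : ℝ)| ≤ ‖t‖ := by
      rw [← Int.norm_eq_abs]; exact norm_le_pi_norm t s
    refine h1.trans (htn.trans ?_)
    rw [hcard, Fintype.card_fin]
    push_cast
    have : (M : ℝ) < K * L := by exact_mod_cast hMKL
    refine Real.rpow_le_rpow (by positivity) (by gcongr) (div_nonneg (by positivity) (by linarith))
  · have := congrFun hAt ⟨m, hm⟩
    simp only [Matrix.mulVec, dotProduct, A, Pi.zero_apply] at this
    have h2 : ((∑ s, (((e s).1 : ℤ) + (e s).2 * q) ^ m * t s : ℤ) : ℝ) = 0 := by exact_mod_cast this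
    push_cast at h2
    rw [← h2]
    exact Finset.sum_congr rfl fun s _ => by ring
  · by_contra hall
    push Not at hall
    apply ht0
    have hz : ∑ s, (t s : ℝ) • (v ∘ e) s = 0 := by
      ext y
      have := hall y.1 y.1.2 y.2 y.2.2
      simpa [v, Finset.sum_apply] using this
    have := Fintype.linearIndependent_iff.mp hli (fun s => (t s : ℝ)) hz
    ext s
    exact_mod_cast this s

theorem one_le_abs_mul_pow_of_isIntegral {K : Type*} [Field K] [NumberField K] (ψ : K →+* ℝ)
    {d : ℕ} (hd : Module.finrank ℚ K ≤ d + 1) {V : K} (hV : IsIntegral ℤ V) (hV0 : V ≠ 0)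
    {H : ℝ} (hH : 1 ≤ H) (hbd : ∀ φ : K →+* ℂ, ‖φ V‖ ≤ H) : 1 ≤ |ψ V| * H ^ d := by
  classical
  have h1 : (1 : ℝ) ≤ ∏ σ : K →ₐ[ℚ] ℂ, ‖σ V‖ := by
    have h := Algebra.norm_eq_prod_embeddings ℚ ℂ V
    rw [← norm_prod, ← h]
    obtain ⟨z, hz⟩ := IsIntegrallyClosed.isIntegral_iff.mp (Algebra.isIntegral_norm ℚ hV)
    have hn0 : Algebra.norm ℚ V ≠ 0 := Algebra.norm_ne_zero_iff.mpr hV0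
    rw [← hz] at hn0 ⊢
    have hz0 : z ≠ 0 := by rintro rfl; simp at hn0
    simp only [eq_intCast, map_intCast, Complex.norm_intCast]
    exact_mod_cast Int.one_le_abs hz0
  let σ₀ : K →ₐ[ℚ] ℂ := (Complex.ofRealHom.comp ψ).toRatAlgHom
  have hσ₀ : ‖σ₀ V‖ = |ψ V| := by simp [σ₀]
  rw [← Finset.mul_prod_erase _ _ (Finset.mem_univ σ₀), hσ₀] at h1
  refine h1.trans (mul_le_mul_of_nonneg_left ?_ (abs_nonneg _))
  calc ∏ σ ∈ Finset.univ.erase σ₀, ‖σ V‖ ≤ ∏ σ ∈ Finset.univ.erase σ₀, H :=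
        Finset.prod_le_prod (fun _ _ => norm_nonneg _) fun σ _ => hbd σ
    _ = H ^ (Finset.univ.erase σ₀).card := by simp
    _ ≤ H ^ d := by
        refine pow_le_pow_right₀ hH ?_
        rw [Finset.card_erase_of_mem (Finset.mem_univ _), Finset.card_univ, AlgHom.card]
        omega

theorem exp_sub_sum_le {n : ℕ} (hn : 0 < n) {x U : ℝ} (hx : 0 ≤ x) (hxU : x ≤ U) (hU0 : 0 < U) (hU : U ≤ n) :
    Real.exp x - ∑ m ∈ Finset.range n, x ^ m / m.factorial ≤ (Real.exp 1 * U / n) ^ n := by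
  have hn' : (0 : ℝ) < n := by exact_mod_cast hn
  set c : ℝ := n / U with hc
  have hc1 : 1 ≤ c := by rw [hc, le_div_iff₀ hU0]; linarith
  have hsum := NormedSpace.expSeries_div_hasSum_exp (𝔸 := ℝ) x
  have hsumc := NormedSpace.expSeries_div_hasSum_exp (𝔸 := ℝ) (c * x)
  rw [← Real.exp_eq_exp_ℝ] at hsum hsumc
  have e1 := hsum.summable.sum_add_tsum_nat_add n
  have e2 := hsumc.summable.sum_add_tsum_nat_add n
  rw [hsum.tsum_eq] at e1
  rw [hsumc.tsum_eq] at e2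
  have h2 : c ^ n * ∑' i, x ^ (i + n) / (i + n).factorial ≤ ∑' i, (c * x) ^ (i + n) / (i + n).factorial := by
    rw [← tsum_mul_left]
    refine Summable.tsum_le_tsum (fun i => ?_) (((summable_nat_add_iff n).mpr hsum.summable).mul_left _)
      ((summable_nat_add_iff n).mpr hsumc.summable)
    rw [mul_pow, ← mul_div_assoc]
    gcongr
    omega
  have h3 : 0 ≤ ∑ m ∈ Finset.range n, (c * x) ^ m / m.factorial :=
    Finset.sum_nonneg fun i _ => by positivity
  have h4 : Real.exp (c * x) ≤ Real.exp 1 ^ n := by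
    rw [← Real.exp_nat_mul]
    refine Real.exp_le_exp.mpr ?_
    calc c * x ≤ c * U := by gcongr
      _ = n * 1 := by rw [hc]; field_simp
  have h5 : Real.exp x - ∑ m ∈ Finset.range n, x ^ m / m.factorial = ∑' i, x ^ (i + n) / (i + n).factorial := by
    linarith
  rw [h5]
  have h6 : (Real.exp 1 * U / n) ^ n = Real.exp 1 ^ n / c ^ n := by
    rw [← div_pow]; congr 1; rw [hc]; field_simp
  rw [h6, le_div_iff₀ (by positivity)]
  linarith

theorem abs_exp_sub_sum_le {n : ℕ} (hn : 0 < n) {x U : ℝ} (hxU : |x| ≤ U) (hU0 : 0 < U) (hU : U ≤ n) :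
    |Real.exp x - ∑ m ∈ Finset.range n, x ^ m / m.factorial| ≤ (Real.exp 1 * U / n) ^ n := by
  have h := Complex.norm_exp_sub_sum_le_exp_norm_sub_sum (x : ℂ) n
  have h1 : Complex.exp x - ∑ m ∈ Finset.range n, (x : ℂ) ^ m / m.factorial =
      ((Real.exp x - ∑ m ∈ Finset.range n, x ^ m / m.factorial : ℝ) : ℂ) := by push_cast; rfl
  rw [h1, Complex.norm_real, Complex.norm_real, Real.norm_eq_abs, Real.norm_eq_abs] at h
  exact h.trans (exp_sub_sum_le hn (abs_nonneg x) hxU hU0 hU)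

theorem abs_sum_exp_poly_le {κ : Type*} [Fintype κ] (x : κ → ℕ × ℕ) (a : κ → ℤ) {I J q K L M n : ℕ}
    {B w b U : ℝ} (hx : ∀ s, (x s).1 < I ∧ (x s).2 < J) (hIq : I ≤ q) (ha : ∀ s, |(a s : ℝ)| ≤ B)
    (hmom : ∀ m < M, ∑ s, (a s : ℝ) * (((x s).1 : ℝ) + (x s).2 * q) ^ m = 0)
    (hw : 0 < w) (hb : 0 < b) (hnM : n + K ≤ M) (hn : 0 < n) (hU0 : 0 < U) (hUn : U ≤ n)
    (hU : J * L * |Real.log b| ≤ U) (hτ : I * L * |Real.log w - Real.log b / q| ≤ 1)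
    {k p : ℕ} (hk : k < K) (hp : p < L) :
    |∑ s, (a s : ℝ) * ((((x s).1 : ℝ) + (x s).2 * q) ^ k * (w ^ (x s).1 * b ^ (x s).2) ^ p)| ≤
      Fintype.card κ * B * (J * q : ℝ) ^ K * ((Real.exp 1 * U / n) ^ n +
        Real.exp U * (2 * (I * L * |Real.log w - Real.log b / q|))) := by
  set τ := Real.log w - Real.log b / q with hτd
  by_cases hq : q = 0
  · have : IsEmpty κ := ⟨fun s => by have := (hx s).1; omega⟩
    simp
  have hq0 : (0 : ℝ) < q := by exact_mod_cast Nat.pos_of_ne_zero hq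
  set u := p * Real.log b / q with hu
  set l : κ → ℝ := fun s => ((x s).1 : ℝ) + (x s).2 * q with hl
  have hl0 : ∀ s, 0 ≤ l s := fun s => by positivity
  have hlJ : ∀ s, l s ≤ J * q := by
    intro s
    have h1 : (x s).1 + (x s).2 * q ≤ J * q := by
      calc (x s).1 + (x s).2 * q ≤ ((x s).2 + 1) * q := by have := (hx s).1; nlinarith
        _ ≤ _ := Nat.mul_le_mul_right _ (hx s).2
    simp only [l]; exact_mod_cast h1
  have hJq : ∀ _ : κ, (1 : ℝ) ≤ J * q := by
    intro s
    have : 1 ≤ J * q := Nat.mul_pos (by have := (hx s).2; omega) (by omega)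
    exact_mod_cast this
  have hlk : ∀ s, (l s) ^ k ≤ (J * q : ℝ) ^ K := fun s =>
    (pow_le_pow_left₀ (hl0 s) (hlJ s) k).trans (pow_le_pow_right₀ (hJq s) hk.le)
  have hlu : ∀ s, |l s * u| ≤ U := by
    intro s
    rw [abs_mul, abs_of_nonneg (hl0 s), hu, abs_div, abs_mul, Nat.abs_cast, Nat.abs_cast]
    refine le_trans ?_ hU
    calc l s * (p * |Real.log b| / q) ≤ (J * q) * (L * |Real.log b| / q) := by
          gcongr; exact hlJ s
      _ = _ := by field_simp
  have hfac : ∀ s, (w ^ (x s).1 * b ^ (x s).2) ^ p = Real.exp (l s * u) * Real.exp ((x s).1 * p * τ) := by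
    intro s
    rw [← Real.exp_add]
    conv_lhs => rw [← Real.exp_log hw, ← Real.exp_log hb]
    rw [← Real.exp_nat_mul, ← Real.exp_nat_mul, ← Real.exp_add, ← Real.exp_nat_mul]
    congr 1
    simp only [hl, hu, hτd]
    field_simp
    ring
  have hτs : ∀ s, |Real.exp ((x s).1 * p * τ) - 1| ≤ 2 * (I * L * |τ|) := by
    intro s
    have h1 : |((x s).1 : ℝ) * p * τ| ≤ I * L * |τ| := by
      rw [abs_mul, abs_mul, Nat.abs_cast, Nat.abs_cast]
      gcongr
      exact (hx s).1.le
    refine (Real.abs_exp_sub_one_le (h1.trans hτ)).trans (by linarith)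
  have hz : ∑ s, (a s : ℝ) * (l s ^ k * ∑ m ∈ Finset.range n, (l s * u) ^ m / m.factorial) = 0 := by
    simp only [Finset.mul_sum]
    rw [Finset.sum_comm]
    refine Finset.sum_eq_zero fun m hm => ?_
    have h := hmom (k + m) (by have := Finset.mem_range.mp hm; omega)
    calc _ = (∑ s, (a s : ℝ) * l s ^ (k + m)) * (u ^ m / m.factorial) := by
          rw [Finset.sum_mul]
          refine Finset.sum_congr rfl fun s _ => ?_
          rw [mul_pow, pow_add]; ring
      _ = 0 := by simp only [hl]; rw [h, zero_mul]
  have hdec : ∑ s, (a s : ℝ) * (l s ^ k * (w ^ (x s).1 * b ^ (x s).2) ^ p) =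
      ∑ s, (a s : ℝ) * (l s ^ k * ((Real.exp (l s * u) - ∑ m ∈ Finset.range n, (l s * u) ^ m / m.factorial)
        + Real.exp (l s * u) * (Real.exp ((x s).1 * p * τ) - 1))) := by
    rw [← sub_zero (∑ s, (a s : ℝ) * (l s ^ k * (w ^ (x s).1 * b ^ (x s).2) ^ p)), ← hz,
      ← Finset.sum_sub_distrib]
    refine Finset.sum_congr rfl fun s _ => ?_
    rw [hfac s]; ring
  rw [hdec]
  refine (Finset.abs_sum_le_sum_abs _ _).trans ?_
  rw [mul_assoc, mul_assoc, ← nsmul_eq_mul, ← Finset.card_univ]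
  refine Finset.sum_le_card_nsmul _ _ _ fun s _ => ?_
  rw [abs_mul, abs_mul, abs_of_nonneg (pow_nonneg (hl0 s) k)]
  have hB : 0 ≤ B := (abs_nonneg _).trans (ha s)
  refine mul_le_mul (ha s) (mul_le_mul (hlk s) ?_ (abs_nonneg _) (by positivity)) (by positivity) hB
  refine (abs_add_le _ _).trans (add_le_add (abs_exp_sub_sum_le hn (hlu s) hU0 hUn) ?_)
  rw [abs_mul, Real.abs_exp]
  refine mul_le_mul (Real.exp_le_exp.mpr ((le_abs_self _).trans (hlu s))) (hτs s) (abs_nonneg _) (Real.exp_pos _).le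

theorem one_le_of_small_linear_form {F : Type*} [Field F] [NumberField F] (ψ : F →+* ℝ)
    {d : ℕ} (hd : Module.finrank ℚ F ≤ d + 1) {w b₁ b₂ : F} (iw : IsIntegral ℤ w)
    (ib₁ : IsIntegral ℤ b₁) (ib₂ : IsIntegral ℤ b₂) {hw hb : ℝ} (hw0 : 0 ≤ hw) (hb0 : 0 < hb)
    (bw : ∀ φ : F →+* ℂ, ‖φ w‖ ≤ Real.exp hw) (bb₁ : ∀ φ : F →+* ℂ, ‖φ b₁‖ ≤ Real.exp hb)
    (bb₂ : ∀ φ : F →+* ℂ, ‖φ b₂‖ ≤ Real.exp hb)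
    (pw : 0 < ψ w) (pw1 : ψ w ≠ 1) (pb₁ : 0 < ψ b₁) (pb₂ : 0 < ψ b₂)
    (lb : |Real.log (ψ b₁ / ψ b₂)| ≤ 2 * hb)
    {K L I J q M n : ℕ} (hK : 1 ≤ K) (hIq : I ≤ q) (hLI : L ≤ I) (hKL : K * L ≤ (I - L) * J)
    (hMKL : M < K * L) (hnM : n + K ≤ M) (hn : 0 < n)
    (hUn : 2 * J * L * hb ≤ n) (hJL : 0 < J * L)
    (hτ : I * L * |Real.log (ψ w) - Real.log (ψ b₁ / ψ b₂) / q| ≤ 1)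
    {S T : ℝ} (hS : (K * L : ℝ) * ((K * L : ℝ) * (J * q : ℝ) ^ M) ^ ((M : ℝ) / ((K * L : ℝ) - M)) *
      (J * q : ℝ) ^ K ≤ S) (hS1 : 1 ≤ S) (hT : L * (I * hw + J * hb) ≤ T) :
    1 ≤ S ^ (d + 1) * Real.exp ((d + 1) * T) * ((Real.exp 1 * (2 * J * L * hb) / n) ^ n +
        Real.exp (2 * J * L * hb) *
          (2 * (I * L * |Real.log (ψ w) - Real.log (ψ b₁ / ψ b₂) / q|))) := by
  obtain ⟨κ, _, x, a, hcard, hx, ha, hmom, k, hk, p, hp, hne⟩ :=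
    exists_auxiliary_coeffs pw pw1 (div_pos pb₁ pb₂) hK hIq hLI hKL (by omega : 1 ≤ M) hMKL
  set B := ((K * L : ℝ) * (J * q : ℝ) ^ M) ^ ((M : ℝ) / ((K * L : ℝ) - M)) with hB
  have hB0 : 0 ≤ B := by positivity
  have hcard' : (Fintype.card κ : ℝ) = K * L := by rw [hcard]; push_cast; ring
  have hJL' : (0 : ℝ) < J * L := by exact_mod_cast hJL
  have hU0 : 0 < 2 * J * L * hb := by
    have := mul_pos hJL' hb0
    nlinarith
  have hbound := abs_sum_exp_poly_le x a hx hIq ha hmom pw (div_pos pb₁ pb₂) hnM hn hU0 hUn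
    (by calc (J : ℝ) * L * |Real.log (ψ b₁ / ψ b₂)| ≤ J * L * (2 * hb) := by gcongr
          _ = _ := by ring) hτ hk hp
  rw [hcard'] at hbound
  set E := ((Real.exp 1 * (2 * J * L * hb) / n) ^ n + Real.exp (2 * J * L * hb) *
          (2 * (I * L * |Real.log (ψ w) - Real.log (ψ b₁ / ψ b₂) / q|))) with hE
  have hE0 : 0 ≤ E := by positivity
  have hpj : ∀ s, (x s).2 * p ≤ J * L := fun s => Nat.mul_le_mul (hx s).2.le hp.le
  let V : F := ∑ s, (a s : F) * (((x s).1 + (x s).2 * q : F) ^ k *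
    (w ^ ((x s).1 * p) * (b₁ ^ ((x s).2 * p) * b₂ ^ (J * L - (x s).2 * p))))
  have hVint : IsIntegral ℤ V := by
    have hnat : ∀ m : ℕ, IsIntegral ℤ (m : F) := fun m => by
      simpa using (isIntegral_algebraMap (R := ℤ) (A := F) (x := (m : ℤ)))
    have h_int : ∀ m : ℤ, IsIntegral ℤ (m : F) := fun m => by
      simpa using (isIntegral_algebraMap (R := ℤ) (A := F) (x := m))
    refine IsIntegral.sum _ fun s _ => (h_int _).mul (IsIntegral.mul (IsIntegral.pow ?_ _) ?_)
    · exact (hnat _).add ((hnat _).mul (hnat _))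
    · exact (iw.pow _).mul ((ib₁.pow _).mul (ib₂.pow _))
  have hψV : ψ V = ψ b₂ ^ (J * L) * ∑ s, (a s : ℝ) * ((((x s).1 : ℝ) + (x s).2 * q) ^ k *
      (ψ w ^ (x s).1 * (ψ b₁ / ψ b₂) ^ (x s).2) ^ p) := by
    simp only [V, map_sum, map_mul, map_pow, map_add, map_intCast, map_natCast, Finset.mul_sum]
    refine Finset.sum_congr rfl fun s _ => ?_
    have h1 : ψ b₂ ^ (J * L) = ψ b₂ ^ (J * L - (x s).2 * p) * ψ b₂ ^ ((x s).2 * p) := by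
      rw [← pow_add, Nat.sub_add_cancel (hpj s)]
    rw [h1, mul_pow, ← pow_mul, ← pow_mul, div_pow]
    have := pb₂.ne'
    field_simp
  have hV0 : V ≠ 0 := by
    intro h
    rw [h, map_zero] at hψV
    exact mul_ne_zero (pow_ne_zero _ pb₂.ne') hne hψV.symm
  have hJq : ∀ _ : κ, (1 : ℝ) ≤ J * q := by
    intro s
    have : 1 ≤ J * q := Nat.mul_pos (by have := (hx s).2; omega) (by have := (hx s).1; omega)
    exact_mod_cast this
  have hconj : ∀ φ : F →+* ℂ, ‖φ V‖ ≤ S * Real.exp T := by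
    intro φ
    have hterm : ∀ s ∈ Finset.univ, ‖φ ((a s : F) * (((x s).1 + (x s).2 * q : F) ^ k *
        (w ^ ((x s).1 * p) * (b₁ ^ ((x s).2 * p) * b₂ ^ (J * L - (x s).2 * p)))))‖ ≤
        B * ((J * q : ℝ) ^ K * Real.exp T) := by
      intro s _
      simp only [map_mul, map_pow, map_add, map_intCast, map_natCast, norm_mul, norm_pow]
      have h1 : ‖((x s).1 : ℂ) + (x s).2 * q‖ = ((x s).1 : ℝ) + (x s).2 * q := by
        have : ((x s).1 : ℂ) + (x s).2 * q = (((x s).1 + (x s).2 * q : ℕ) : ℂ) := by push_cast; ring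
        rw [this, Complex.norm_natCast]; push_cast; ring
      rw [h1, Complex.norm_intCast]
      have h2 : ((x s).1 : ℝ) + (x s).2 * q ≤ J * q := by
        have h1 : (x s).1 + (x s).2 * q ≤ J * q := by
          calc (x s).1 + (x s).2 * q ≤ ((x s).2 + 1) * q := by have := (hx s).1; nlinarith
            _ ≤ _ := Nat.mul_le_mul_right _ (hx s).2
        exact_mod_cast h1
      have h3 : (((x s).1 : ℝ) + (x s).2 * q) ^ k ≤ (J * q : ℝ) ^ K :=
        (pow_le_pow_left₀ (by positivity) h2 k).trans (pow_le_pow_right₀ (hJq s) hk.le)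
      have h4 : ‖φ w‖ ^ ((x s).1 * p) ≤ Real.exp (L * (I * hw)) := by
        calc ‖φ w‖ ^ ((x s).1 * p) ≤ Real.exp hw ^ ((x s).1 * p) := by gcongr; exact bw φ
          _ ≤ Real.exp hw ^ (I * L) := pow_le_pow_right₀ (Real.one_le_exp hw0)
              (Nat.mul_le_mul (hx s).1.le hp.le)
          _ = _ := by rw [← Real.exp_nat_mul]; congr 1; push_cast; ring
      have h5 : ‖φ b₁‖ ^ ((x s).2 * p) * ‖φ b₂‖ ^ (J * L - (x s).2 * p) ≤ Real.exp (L * (J * hb)) := by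
        calc _ ≤ Real.exp hb ^ ((x s).2 * p) * Real.exp hb ^ (J * L - (x s).2 * p) := by
              gcongr
              · exact bb₁ φ
              · exact bb₂ φ
          _ = Real.exp hb ^ (J * L) := by rw [← pow_add, Nat.add_sub_cancel' (hpj s)]
          _ = _ := by rw [← Real.exp_nat_mul]; congr 1; push_cast; ring
      refine mul_le_mul (ha s) (mul_le_mul h3 ?_ (by positivity) (by positivity)) (by positivity) hB0
      calc _ ≤ Real.exp (L * (I * hw)) * Real.exp (L * (J * hb)) :=
            mul_le_mul h4 h5 (by positivity) (by positivity)
        _ = Real.exp (L * (I * hw + J * hb)) := by rw [← Real.exp_add]; congr 1; ring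
        _ ≤ _ := Real.exp_le_exp.mpr hT
    simp only [V, map_sum]
    refine (norm_sum_le _ _).trans ((Finset.sum_le_card_nsmul _ _ _ hterm).trans ?_)
    rw [Finset.card_univ, nsmul_eq_mul, hcard']
    calc _ = (K * L : ℝ) * B * (J * q : ℝ) ^ K * Real.exp T := by ring
      _ ≤ _ := by gcongr
  have hT0 : 0 ≤ T := le_trans (by positivity) hT
  have h1 := one_le_abs_mul_pow_of_isIntegral ψ hd hVint hV0
    (one_le_mul_of_one_le_of_one_le hS1 (Real.one_le_exp hT0)) hconj
  refine h1.trans ?_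
  rw [hψV, abs_mul, abs_of_nonneg (by positivity)]
  have h2 : ψ b₂ ^ (J * L) ≤ Real.exp T := by
    have h3 : ψ b₂ ≤ Real.exp hb := by
      have := bb₂ (Complex.ofRealHom.comp ψ)
      simp only [RingHom.comp_apply, Complex.ofRealHom_eq_coe, Complex.norm_real, Real.norm_eq_abs] at this
      exact (le_abs_self _).trans this
    calc _ ≤ Real.exp hb ^ (J * L) := by gcongr
      _ = Real.exp (L * (J * hb)) := by rw [← Real.exp_nat_mul]; congr 1; push_cast; ring
      _ ≤ _ := Real.exp_le_exp.mpr (le_trans (by gcongr; nlinarith [mul_nonneg (Nat.cast_nonneg (α := ℝ) I) hw0]) hT)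
  calc _ ≤ Real.exp T * (S * E) * (S * Real.exp T) ^ d := by
        gcongr
        refine hbound.trans ?_
        gcongr
    _ = S ^ (d + 1) * Real.exp T ^ (d + 1) * E := by ring
    _ = _ := by rw [← Real.exp_nat_mul]; push_cast; ring

theorem mul_rpow_mul_pow_le_exp {g K : ℕ} {ℓ x y : ℝ} (hg : 2 ≤ g) (hK : 1 ≤ K) (hℓ : 0 ≤ ℓ)
    (hx0 : 0 ≤ x) (hx : x ≤ Real.exp (2 * ℓ)) (hy0 : 0 ≤ y) (hy : y ≤ Real.exp (2 * ℓ)) :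
    x * (x * y ^ (g * K)) ^ (1 / ((g : ℝ) - 1)) * y ^ K ≤ Real.exp (10 * K * ℓ) := by
  have hg' : (2 : ℝ) ≤ g := by exact_mod_cast hg
  have hK' : (1 : ℝ) ≤ K := by exact_mod_cast hK
  have h1 : (x * y ^ (g * K)) ^ (1 / ((g : ℝ) - 1)) ≤ Real.exp (2 * ℓ + 4 * K * ℓ) := by
    have he : Real.exp (2 * ℓ) * Real.exp (2 * ℓ) ^ (g * K) = Real.exp (2 * ℓ + g * K * (2 * ℓ)) := by
      rw [← Real.exp_nat_mul, ← Real.exp_add]; push_cast; ring_nf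
    have hp : 0 ≤ 1 / ((g : ℝ) - 1) := div_nonneg zero_le_one (by linarith)
    calc _ ≤ (Real.exp (2 * ℓ) * Real.exp (2 * ℓ) ^ (g * K)) ^ (1 / ((g : ℝ) - 1)) := by
          gcongr
      _ = Real.exp ((2 * ℓ + g * K * (2 * ℓ)) * (1 / ((g : ℝ) - 1))) := by
          rw [he, ← Real.exp_mul]
      _ ≤ _ := by
          apply Real.exp_le_exp.mpr
          rw [mul_one_div, div_le_iff₀ (by linarith)]
          have h3 : (g : ℝ) ≤ 2 * (g - 1) := by linarith
          have : 0 ≤ K * ℓ := by positivity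
          nlinarith [mul_le_mul_of_nonneg_right h3 this]
  calc _ ≤ Real.exp (2 * ℓ) * Real.exp (2 * ℓ + 4 * K * ℓ) * Real.exp (2 * ℓ) ^ K := by
        gcongr
    _ = Real.exp (4 * ℓ + 6 * K * ℓ) := by
        rw [← Real.exp_nat_mul, ← Real.exp_add, ← Real.exp_add]; congr 1; ring
    _ ≤ _ := by
        apply Real.exp_le_exp.mpr
        nlinarith

set_option maxHeartbeats 1000000 in
theorem small_linear_form_false_of_parameters {F : Type*} [Field F] [NumberField F] (ψ : F →+* ℝ)
    (hd : Module.finrank ℚ F ≤ 4) {w b₁ b₂ : F} (iw : IsIntegral ℤ w)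
    (ib₁ : IsIntegral ℤ b₁) (ib₂ : IsIntegral ℤ b₂) {hw hb : ℝ} (hw0 : 0 ≤ hw) (hb0 : 0 < hb)
    (bw : ∀ φ : F →+* ℂ, ‖φ w‖ ≤ Real.exp hw) (bb₁ : ∀ φ : F →+* ℂ, ‖φ b₁‖ ≤ Real.exp hb)
    (bb₂ : ∀ φ : F →+* ℂ, ‖φ b₂‖ ≤ Real.exp hb)
    (pw : 0 < ψ w) (pw1 : ψ w ≠ 1) (pb₁ : 0 < ψ b₁) (pb₂ : 0 < ψ b₂)
    (lb : |Real.log (ψ b₁ / ψ b₂)| ≤ 2 * hb)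
    {q g : ℕ} {C c Y Z : ℝ} (hg : 2 ≤ g) (hC : 1 ≤ C) (hc : 0 < c) (hY : 3 ≤ Y) (hZ1 : 1 ≤ Z)
    (hbC : hb * Z ^ 4 ≤ C * q) (hwC : hw * q ≤ C * Y) (hqY : q ≤ C * Y)
    (hqZ : (2 * (g : ℝ) ^ 2 + 1) * Z ^ 2 ≤ q) (hZY : 2 * Z ≤ Y) (hZC : 96 * C * (g : ℝ) ^ 4 ≤ Z)
    (hZlog : 46 * Real.log Y ≤ (g - 1) * Real.log Z)
    (hZc : 180 * Real.log Y ≤ c * Z)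
    (hexp : 8 * C * (g : ℝ) ^ 2 * Y ≤ Real.exp (c * Y / 2))
    (hτ : |Real.log (ψ w) - Real.log (ψ b₁ / ψ b₂) / q| ≤ Real.exp (-(c * Y))) : False := by
  set ℓ := Real.log Y with hℓ
  set τ := |Real.log (ψ w) - Real.log (ψ b₁ / ψ b₂) / q| with hτd
  have hτ0 : 0 ≤ τ := abs_nonneg _
  have hℓ1 : 1 ≤ ℓ := by
    rw [hℓ, Real.le_log_iff_exp_le (by linarith)]
    have := Real.exp_one_lt_d9; linarith
  have hZ0 : 0 < Z := by linarith
  have hY0 : 0 < Y := by linarith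
  have hg' : (2 : ℝ) ≤ g := by exact_mod_cast hg
  have hq0 : (0 : ℝ) < q := lt_of_lt_of_le (by positivity) hqZ
  set L := g ^ 2 with hL
  have hLr : (L : ℝ) = (g : ℝ) ^ 2 := by rw [hL]; push_cast; ring
  have hL4 : 4 ≤ L := by rw [hL]; exact Nat.pow_le_pow_left hg 2
  have hL4' : (4 : ℝ) ≤ L := by exact_mod_cast hL4
  have hg4 : (g : ℝ) ^ 4 = L ^ 2 := by rw [hLr]; ring
  rw [hg4] at hZC
  rw [← hLr] at hqZ hexp
  set I := ⌊(q : ℝ) / Z ^ 2⌋₊ with hI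
  set J := ⌈Y / q * Z⌉₊ with hJ
  have hqZ' : 2 * (L : ℝ) + 1 ≤ q / Z ^ 2 := by rw [le_div_iff₀ (by positivity)]; exact hqZ
  have hI1 : (I : ℝ) ≤ q / Z ^ 2 := Nat.floor_le (by positivity)
  have hI2 : (q : ℝ) / Z ^ 2 < I + 1 := Nat.lt_floor_add_one _
  have hI3 : 2 * L ≤ I := by
    have : (2 * L : ℝ) ≤ I := by linarith
    exact_mod_cast this
  have hI4 : q / Z ^ 2 ≤ 2 * (I : ℝ) := by linarith
  have hC0 : 0 < C := by linarith
  have hCZ : C ≤ Z := by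
    refine le_trans ?_ hZC
    have h1 : (1 : ℝ) ≤ L ^ 2 := one_le_pow₀ (by linarith)
    have := mul_le_mul_of_nonneg_left h1 hC0.le
    linarith
  have hYq : 1 ≤ Y / q * Z := by
    rw [div_mul_eq_mul_div, le_div_iff₀ hq0, one_mul, mul_comm]
    exact hqY.trans (by gcongr)
  have hJ1 : Y / q * Z ≤ J := Nat.le_ceil _
  have hJ2 : (J : ℝ) ≤ 2 * (Y / q * Z) := by
    have := Nat.ceil_lt_add_one (show 0 ≤ Y / q * Z by positivity)
    linarith
  have hJp : 1 ≤ J := Nat.one_le_iff_ne_zero.mpr (by intro h; rw [h] at hJ1; norm_num at hJ1; linarith)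
  have hIq : I ≤ q := by
    have : (I : ℝ) ≤ q := hI1.trans (div_le_self hq0.le (one_le_pow₀ hZ1))
    exact_mod_cast this
  set W := Y / Z with hW
  have hW0 : 0 < W := by positivity
  have hIJ1 : W ≤ 2 * (I * J : ℝ) := by
    calc W = (q / Z ^ 2) * (Y / q * Z) := by rw [hW]; field_simp
      _ ≤ (2 * I) * J := by gcongr
      _ = _ := by ring
  have hIJ2 : (I * J : ℝ) ≤ 2 * W := by
    calc (I * J : ℝ) ≤ (q / Z ^ 2) * (2 * (Y / q * Z)) := by gcongr
      _ = _ := by rw [hW]; field_simp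
  set K := (I - L) * J / L with hK
  have hK1 : K * L ≤ (I - L) * J := Nat.div_mul_le_self _ _
  have hK2 : (I - L) * J < (K + 1) * L := by
    rw [mul_comm _ L]; exact Nat.lt_mul_div_succ _ (by omega)
  have hKp : 1 ≤ K := by
    rw [hK, Nat.one_le_div_iff (by omega)]
    calc L = L * 1 := by ring
      _ ≤ _ := Nat.mul_le_mul (by omega) hJp
  have hKL : (K * L : ℝ) ≤ I * J := by
    have : K * L ≤ I * J := hK1.trans (Nat.mul_le_mul_right _ (Nat.sub_le _ _))
    exact_mod_cast this
  have hKL2 : (I * J : ℝ) ≤ 4 * (K * L) := by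
    have h1 : I * J ≤ 2 * ((I - L) * J) := by rw [← mul_assoc]; exact Nat.mul_le_mul_right _ (by omega)
    have h2 : (K + 1) * L ≤ 2 * (K * L) := by
      rw [← mul_assoc]; exact Nat.mul_le_mul_right _ (by omega)
    have : I * J ≤ 4 * (K * L) := by omega
    exact_mod_cast this
  have hKp' : (1 : ℝ) ≤ K := by exact_mod_cast hKp
  have hWK : W ≤ 8 * L * K := by linarith
  have hKW : L * (K : ℝ) ≤ 2 * W := by linarith
  have hIw : I * hw ≤ C * W / Z := by
    calc I * hw ≤ (q / Z ^ 2) * hw := by gcongr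
      _ = (hw * q) / Z ^ 2 := by ring
      _ ≤ (C * Y) / Z ^ 2 := by gcongr
      _ = _ := by rw [hW]; field_simp
  have hJb : J * hb ≤ 2 * C * W / Z ^ 2 := by
    calc J * hb ≤ 2 * (Y / q * Z) * hb := by gcongr
      _ = 2 * Y / (q * Z ^ 3) * (hb * Z ^ 4) := by field_simp
      _ ≤ 2 * Y / (q * Z ^ 3) * (C * q) := by gcongr
      _ = _ := by rw [hW]; field_simp
  have hT : L * (I * hw + J * hb) ≤ K := by
    have h1 : 2 * C * W / Z ^ 2 ≤ 2 * C * W / Z := by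
      gcongr; exact le_self_pow₀ hZ1 (by norm_num)
    have h2 : C * W / Z ≤ C * (8 * L * K) / (96 * C * L ^ 2) := by gcongr
    have h3 : C * (8 * L * K) / (96 * C * L ^ 2) = K / (12 * L) := by field_simp; norm_num
    have h4 : I * hw + J * hb ≤ 3 * (K / (12 * L)) := by
      have : 2 * C * W / Z = 2 * (C * W / Z) := by ring
      linarith
    calc L * (I * hw + J * hb) ≤ L * (3 * (K / (12 * L))) := by gcongr
      _ = K / 4 := by field_simp; norm_num
      _ ≤ K := by linarith
  clear_value I J K
  set n := (g - 1) * K with hn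
  have hnr : (n : ℝ) = (g - 1) * K := by rw [hn]; push_cast [Nat.cast_sub (by omega : 1 ≤ g)]; ring
  have hKn : (K : ℝ) ≤ n := by
    rw [hnr]; exact le_mul_of_one_le_left (by positivity) (by linarith)
  set U := 2 * J * L * hb with hU
  have hUZ : Real.exp 1 * U * Z ≤ K := by
    have h2 : C * W / Z ≤ C * (8 * L * K) / (96 * C * L ^ 2) := by gcongr
    have h3 : C * (8 * L * K) / (96 * C * L ^ 2) = K / (12 * L) := by field_simp; norm_num
    have he : Real.exp 1 ≤ 3 := by have := Real.exp_one_lt_d9; linarith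
    calc Real.exp 1 * U * Z ≤ 3 * U * Z := by gcongr
      _ = 6 * L * Z * (J * hb) := by rw [hU]; ring
      _ ≤ 6 * L * Z * (2 * C * W / Z ^ 2) := by gcongr
      _ = 12 * L * (C * W / Z) := by field_simp; norm_num
      _ ≤ 12 * L * (K / (12 * L)) := by rw [← h3]; gcongr
      _ = K := by field_simp
  have hU0 : 0 ≤ U := by positivity
  have hUK : U ≤ K := by
    have : 1 ≤ Real.exp 1 := Real.one_le_exp zero_le_one
    have h1 : U * 1 ≤ U * (Real.exp 1 * Z) := by
      gcongr; exact one_le_mul_of_one_le_of_one_le this hZ1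
    linarith
  have hτI : 2 * (I * L * τ) ≤ Real.exp (-(c * Y / 2)) / 2 ∧ I * L * τ ≤ 1 := by
    have h1 : 2 * (I * L * τ) ≤ Real.exp (-(c * Y / 2)) / 4 := by
      have hIC : (I : ℝ) ≤ C * Y := le_trans (by exact_mod_cast hIq) hqY
      calc 2 * (I * L * τ) ≤ 2 * ((C * Y) * L * Real.exp (-(c * Y))) := by gcongr
        _ = (8 * C * L * Y) * Real.exp (-(c * Y)) / 4 := by ring
        _ ≤ Real.exp (c * Y / 2) * Real.exp (-(c * Y)) / 4 := by gcongr
        _ = _ := by rw [← Real.exp_add]; congr 2; ring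
    have h2 : Real.exp (-(c * Y / 2)) ≤ 1 := by
      rw [Real.exp_le_one_iff]; have : 0 < c * Y := by positivity
      linarith
    have h3 := Real.exp_pos (-(c * Y / 2))
    constructor <;> linarith
  have hJq : (1 : ℝ) ≤ J * q := by
    have : 1 ≤ J * q := Nat.mul_pos hJp (by exact_mod_cast hq0)
    exact_mod_cast this
  have hJqY : (J * q : ℝ) ≤ Y ^ 2 := by
    calc (J * q : ℝ) ≤ 2 * (Y / q * Z) * q := by gcongr
      _ = Y * (2 * Z) := by field_simp
      _ ≤ Y * Y := by gcongr
      _ = _ := by ring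
  have hJqexp : (J * q : ℝ) ≤ Real.exp (2 * ℓ) := by
    refine hJqY.trans (le_of_eq ?_)
    rw [two_mul, Real.exp_add, hℓ, Real.exp_log hY0]; ring
  have hKLexp : (K * L : ℝ) ≤ Real.exp (2 * ℓ) := by
    refine le_trans (hKL.trans ?_) hJqexp
    rw [mul_comm]
    gcongr
  have hKLp : (0 : ℝ) < K * L := by positivity
  have hexpo : (((g * K : ℕ) : ℝ) / ((K * L : ℝ) - (g * K : ℕ))) = 1 / (g - 1) := by
    rw [hLr]; push_cast
    have : (g : ℝ) - 1 ≠ 0 := by linarith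
    rw [show (K : ℝ) * g ^ 2 - g * K = g * K * (g - 1) by ring]
    field_simp
  have hg1 : (1 : ℝ) ≤ g - 1 := by linarith
  have hS : (K * L : ℝ) * ((K * L : ℝ) * (J * q : ℝ) ^ (g * K)) ^ (((g * K : ℕ) : ℝ) / ((K * L : ℝ) - (g * K : ℕ))) *
      (J * q : ℝ) ^ K ≤ Real.exp (10 * K * ℓ) := by
    rw [hexpo]
    exact mul_rpow_mul_pow_le_exp hg hKp (by linarith) hKLp.le hKLexp (by positivity) hJqexp
  have key := one_le_of_small_linear_form (d := 3) ψ (by omega) iw ib₁ ib₂ hw0 hb0 bw bb₁ bb₂ pw pw1 pb₁ pb₂ lb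
    (K := K) (L := L) (I := I) (J := J) (q := q) (M := g * K) (n := n) hKp hIq (by omega) hK1
    (by rw [hL, mul_comm K]; exact Nat.mul_lt_mul_of_pos_right (lt_self_pow₀ (by omega) (by norm_num)) hKp)
    (by rw [hn]; obtain ⟨g', rfl⟩ : ∃ g', g = g' + 1 := ⟨g - 1, by omega⟩; simp; ring_nf; rfl)
    (by rw [hn]; exact Nat.mul_pos (by omega) hKp)
    (hUK.trans hKn) (Nat.mul_pos hJp (by omega)) hτI.2 hS
    (Real.one_le_exp (by positivity)) hT
  rw [← Real.exp_nat_mul, ← Real.exp_add] at key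
  push_cast at key
  rw [← hτd, ← hU] at key
  clear_value n U τ W ℓ
  have hKl : (1 : ℝ) ≤ K * ℓ := one_le_mul_of_one_le_of_one_le hKp' hℓ1
  have hKl' : (K : ℝ) ≤ K * ℓ := le_mul_of_one_le_right (by positivity) hℓ1
  have hmain : (Real.exp 1 * U / n) ^ n ≤ Real.exp (-(46 * (K * ℓ))) := by
    have hn0 : (0 : ℝ) < n := by linarith
    have h1 : Real.exp 1 * U / n ≤ Real.exp (-Real.log Z) := by
      rw [Real.exp_neg, Real.exp_log hZ0, div_le_iff₀ hn0, inv_mul_eq_div, le_div_iff₀ hZ0]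
      exact hUZ.trans hKn
    calc _ ≤ Real.exp (-Real.log Z) ^ n := by gcongr
      _ = Real.exp (-(n * Real.log Z)) := by rw [← Real.exp_nat_mul]; congr 1; ring
      _ ≤ _ := by
        apply Real.exp_le_exp.mpr
        rw [hnr]
        have := mul_le_mul_of_nonneg_left hZlog (by positivity : (0:ℝ) ≤ K)
        linarith
  have htail : Real.exp U * (2 * (I * L * τ)) ≤ Real.exp (-(44 * (K * ℓ))) / 2 := by
    calc _ ≤ Real.exp K * (Real.exp (-(c * Y / 2)) / 2) := by
          gcongr
          exact hτI.1
      _ = Real.exp (K - c * Y / 2) / 2 := by rw [sub_eq_add_neg, Real.exp_add]; ring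
      _ ≤ _ := by
        gcongr
        have h1 : K * ℓ ≤ W / 2 * ℓ := by
          have : 4 * (K : ℝ) ≤ L * K := by gcongr
          gcongr; linarith
        have h2 : 90 * (W * ℓ) ≤ c * Y / 2 := by
          have : c * Y = c * Z * W := by rw [hW]; field_simp
          rw [this]
          have := mul_le_mul_of_nonneg_right hZc hW0.le
          linarith
        linarith
  have h2 : Real.exp (-(46 * (K * ℓ))) ≤ Real.exp (-(44 * (K * ℓ))) * Real.exp (-2) := by
    rw [← Real.exp_add]; apply Real.exp_le_exp.mpr; linarith
  have h3 : Real.exp (-2) < 1 / 2 := by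
    rw [Real.exp_neg, inv_lt_comm₀ (Real.exp_pos _) (by norm_num)]
    have := Real.add_one_lt_exp (x := 2) (by norm_num)
    norm_num; linarith
  have h4 : (Real.exp (4 * (10 * K * ℓ) + (3 + 1) * K)) ≤ Real.exp (44 * (K * ℓ)) := by
    apply Real.exp_le_exp.mpr; linarith
  have h5 : Real.exp (44 * (K * ℓ)) * Real.exp (-(44 * (K * ℓ))) = 1 := by
    rw [← Real.exp_add]; simp
  have h6 := Real.exp_pos (-(44 * (K * ℓ)))
  have h7 : (Real.exp 1 * U / n) ^ n + Real.exp U * (2 * (I * L * τ)) < Real.exp (-(44 * (K * ℓ))) := by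
    have := mul_lt_mul_of_pos_left h3 h6
    linarith
  have h8 : 0 ≤ (Real.exp 1 * U / n) ^ n + Real.exp U * (2 * (I * L * τ)) := by positivity
  have := calc (1 : ℝ) ≤ _ := key
    _ ≤ Real.exp (44 * (K * ℓ)) * ((Real.exp 1 * U / n) ^ n + Real.exp U * (2 * (I * L * τ))) := by
        gcongr
    _ < Real.exp (44 * (K * ℓ)) * Real.exp (-(44 * (K * ℓ))) := by gcongr
    _ = 1 := h5
  exact lt_irrefl _ this

theorem eventually_const_mul_rpow_le {a b : ℝ} (A : ℝ) (h : a < b) :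
    ∀ᶠ Y : ℝ in atTop, A * Y ^ a ≤ Y ^ b := by
  filter_upwards [(tendsto_rpow_atTop (sub_pos.mpr h)).eventually_ge_atTop A, eventually_gt_atTop 0]
    with Y h1 h2
  calc A * Y ^ a ≤ Y ^ (b - a) * Y ^ a := by gcongr
    _ = Y ^ b := by rw [← Real.rpow_add h2]; congr 1; ring

theorem eventually_const_mul_log_le_rpow {b : ℝ} (A : ℝ) (h : 0 < b) :
    ∀ᶠ Y : ℝ in atTop, A * Real.log Y ≤ Y ^ b := by
  filter_upwards [eventually_const_mul_rpow_le (|A| / (b / 2)) (show b / 2 < b by linarith),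
    eventually_ge_atTop 1] with Y h1 h2
  refine le_trans ?_ h1
  have h3 := Real.log_le_rpow_div (by linarith : 0 ≤ Y) (half_pos h)
  calc A * Real.log Y ≤ |A| * Real.log Y := by gcongr; exacts [Real.log_nonneg h2, le_abs_self A]
    _ ≤ |A| * (Y ^ (b / 2) / (b / 2)) := by gcongr
    _ = _ := by ring

theorem eventually_const_mul_le_exp {c : ℝ} (A : ℝ) (hc : 0 < c) :
    ∀ᶠ Y : ℝ in atTop, A * Y ≤ Real.exp (c * Y) := by
  have h := (tendsto_id.const_mul_atTop hc).eventually
    ((tendsto_exp_div_rpow_atTop 1).eventually_ge_atTop (A / c))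
  filter_upwards [h, eventually_gt_atTop 0] with Y h1 h2
  simp only [id, Real.rpow_one] at h1
  rw [div_le_div_iff₀ hc (by positivity)] at h1
  nlinarith

/-- An asymptotic lower bound for a linear form in two logarithms of algebraic integers. -/
theorem eventually_small_linear_form_false {C c δ : ℝ} (hC : 1 ≤ C) (hc : 0 < c) (hδ : 0 < δ)
    (hδ1 : δ < 1) : ∀ᶠ Y : ℝ in atTop, ∀ (F : Type) [Field F] [NumberField F] (ψ : F →+* ℝ)
    (w b₁ b₂ : F) (hw hb : ℝ) (q : ℕ), Module.finrank ℚ F ≤ 4 → IsIntegral ℤ w →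
    IsIntegral ℤ b₁ → IsIntegral ℤ b₂ → 0 ≤ hw → 0 < hb →
    (∀ φ : F →+* ℂ, ‖φ w‖ ≤ Real.exp hw) → (∀ φ : F →+* ℂ, ‖φ b₁‖ ≤ Real.exp hb) →
    (∀ φ : F →+* ℂ, ‖φ b₂‖ ≤ Real.exp hb) → 0 < ψ w → ψ w ≠ 1 → 0 < ψ b₁ → 0 < ψ b₂ →
    |Real.log (ψ b₁ / ψ b₂)| ≤ 2 * hb → hb * Y ^ δ ≤ C * q → hw * q ≤ C * Y → q ≤ C * Y →
    Y ^ δ ≤ q →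
    ¬ |Real.log (ψ w) - Real.log (ψ b₁ / ψ b₂) / q| ≤ Real.exp (-(c * Y)) := by
  obtain ⟨g₀, hg₀⟩ := exists_nat_ge (184 / δ)
  set g := g₀ + 2 with hg
  have hg46 : 46 ≤ ((g : ℝ) - 1) * (δ / 4) := by
    rw [div_le_iff₀ hδ] at hg₀
    rw [hg]; push_cast
    nlinarith
  have e1 := eventually_const_mul_rpow_le (2 * (g : ℝ) ^ 2 + 1) (show δ / 2 < δ by linarith)
  have e2 := eventually_const_mul_rpow_le 2 (show δ / 4 < 1 by linarith)
  have e3 := (tendsto_rpow_atTop (show 0 < δ / 4 by linarith)).eventually_ge_atTop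
    (96 * C * (g : ℝ) ^ 4)
  have e4 := eventually_const_mul_log_le_rpow (180 / c) (show 0 < δ / 4 by linarith)
  have e5 := eventually_const_mul_le_exp (8 * C * (g : ℝ) ^ 2) (show 0 < c / 2 by linarith)
  filter_upwards [e1, e2, e3, e4, e5, eventually_ge_atTop 3] with Y h1 h2 h3 h4 h5 hY
  intro F _ _ ψ w b₁ b₂ hw hb q hd iw ib₁ ib₂ hw0 hb0 bw bb₁ bb₂ pw pw1 pb₁ pb₂ lb hbC hwC hqY hqZ hτ
  have hY0 : 0 < Y := by linarith
  have hZ2 : (Y ^ (δ / 4)) ^ 2 = Y ^ (δ / 2) := by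
    rw [← Real.rpow_natCast, ← Real.rpow_mul hY0.le]; congr 1; push_cast; ring
  have hZ4 : (Y ^ (δ / 4)) ^ 4 = Y ^ δ := by
    rw [← Real.rpow_natCast, ← Real.rpow_mul hY0.le]; congr 1; push_cast; ring
  refine small_linear_form_false_of_parameters ψ hd iw ib₁ ib₂ hw0 hb0 bw bb₁ bb₂ pw pw1 pb₁ pb₂ lb
    (Z := Y ^ (δ / 4)) (g := g) (by omega) hC hc hY (Real.one_le_rpow (by linarith) (by linarith))
    (by rwa [hZ4]) hwC hqY (by rw [hZ2]; exact h1.trans hqZ) (by simpa using h2) h3 ?_ ?_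
    (by rw [show c * Y / 2 = c / 2 * Y by ring]; exact h5) hτ
  · rw [Real.log_rpow hY0, ← mul_assoc]
    gcongr
    exact Real.log_nonneg (by linarith)
  · rw [div_mul_eq_mul_div, div_le_iff₀ hc] at h4
    linarith

theorem unit_reduction {F : Type} [Field F] (ψ : F →+* ℝ) {e α : F}
    {l a a₀ : ℝ} (ie : IsIntegral ℤ e⁻¹) (iα : IsIntegral ℤ α) (he : ψ e = Real.exp l)
    (hα : ψ α = Real.exp a) (hl : 0 < l) (ha : 0 ≤ a) (ha₀ : 0 ≤ a₀)
    (hφ : ∀ φ : F →+* ℂ, (‖φ α‖ = Real.exp a ∧ ‖φ e‖ = Real.exp l) ∨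
      (‖φ α‖ ≤ Real.exp (a₀ - a) ∧ ‖φ e‖ = Real.exp (-l))) :
    IsIntegral ℤ (α * e⁻¹ ^ ⌊a / l⌋₊) ∧ ψ (α * e⁻¹ ^ ⌊a / l⌋₊) = Real.exp (a - ⌊a / l⌋₊ * l) ∧
      (∀ φ : F →+* ℂ, ‖φ (α * e⁻¹ ^ ⌊a / l⌋₊)‖ ≤ Real.exp (a₀ + l)) ∧
      0 ≤ a - ⌊a / l⌋₊ * l ∧ a - ⌊a / l⌋₊ * l ≤ l := by
  have h1 : (⌊a / l⌋₊ : ℝ) * l ≤ a := by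
    rw [← le_div_iff₀ hl]; exact Nat.floor_le (by positivity)
  have h2 : a ≤ (⌊a / l⌋₊ + 1 : ℝ) * l := by
    rw [← div_le_iff₀ hl]; exact (Nat.lt_floor_add_one _).le
  refine ⟨iα.mul (ie.pow _), ?_, fun φ => ?_, by linarith, by linarith⟩
  · rw [map_mul, map_pow, map_inv₀, he, hα, ← Real.exp_neg, ← Real.exp_nat_mul, ← Real.exp_add]
    congr 1; ring
  · rw [map_mul, map_pow, map_inv₀, norm_mul, norm_pow, norm_inv]
    rcases hφ φ with ⟨h3, h4⟩ | ⟨h3, h4⟩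
    · rw [h3, h4, ← Real.exp_neg, ← Real.exp_nat_mul, ← Real.exp_add]
      apply Real.exp_le_exp.mpr; linarith
    · rw [h4, ← Real.exp_neg, ← Real.exp_nat_mul]
      calc _ ≤ Real.exp (a₀ - a) * Real.exp (⌊a / l⌋₊ * - -l) := by gcongr
        _ = Real.exp (a₀ - a + ⌊a / l⌋₊ * l) := by rw [← Real.exp_add]; congr 1; ring
        _ ≤ _ := by apply Real.exp_le_exp.mpr; linarith

theorem unit_zpow_bounds {F : Type} [Field F] (ψ : F →+* ℝ) {e : F} {l : ℝ} (hl : 0 ≤ l)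
    (ie : IsIntegral ℤ e) (ie' : IsIntegral ℤ e⁻¹) (he : ψ e = Real.exp l)
    (hφ : ∀ φ : F →+* ℂ, ‖φ e‖ = Real.exp l ∨ ‖φ e‖ = Real.exp (-l)) (z : ℤ) :
    IsIntegral ℤ (e ^ z) ∧ ψ (e ^ z) = Real.exp (z * l) ∧
      ∀ φ : F →+* ℂ, ‖φ (e ^ z)‖ ≤ Real.exp (|(z : ℝ)| * l) := by
  refine ⟨?_, ?_, fun φ => ?_⟩
  · rcases Int.eq_nat_or_neg z with ⟨n, rfl | rfl⟩
    · rw [zpow_natCast]; exact ie.pow n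
    · rw [zpow_neg, zpow_natCast, ← inv_pow]; exact ie'.pow n
  · rw [map_zpow₀, he, ← Real.rpow_intCast, ← Real.exp_mul, mul_comm]
  · rw [map_zpow₀, norm_zpow]
    rcases hφ φ with h | h <;> rw [h, ← Real.rpow_intCast, ← Real.exp_mul, mul_comm] <;> apply Real.exp_le_exp.mpr
    · gcongr; exact le_abs_self _
    · rw [mul_neg, ← neg_mul]; gcongr; exact neg_le_abs _

set_option maxHeartbeats 1000000 in
theorem eventually_unit_relation_false {C c δ μ κ : ℝ} (hC : 1 ≤ C) (hc : 0 < c) (hδ : 0 < δ)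
    (hδ1 : δ < 1) (hμ : 0 < μ) (h4μ : 4 * μ + 3 * δ < 1) (hκ : κ + 2 * μ + 2 * δ < 1) :
    ∀ᶠ Y : ℝ in atTop, ∀ (F : Type) [Field F] [NumberField F] (ψ : F →+* ℝ)
    (e e' α α' r r' : F) (l l' a a' a₀ : ℝ), Module.finrank ℚ F ≤ 4 →
    IsIntegral ℤ e → IsIntegral ℤ e⁻¹ → IsIntegral ℤ e' → IsIntegral ℤ e'⁻¹ →
    IsIntegral ℤ α → IsIntegral ℤ α' → IsIntegral ℤ r → IsIntegral ℤ r' →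
    ψ e = Real.exp l → ψ e' = Real.exp l' → ψ α = Real.exp a → ψ α' = Real.exp a' →
    1 / 2 ≤ l → l ≤ Y ^ μ → 1 / 2 ≤ l' → l' ≤ Y ^ μ →
    c * Y ≤ a → a ≤ C * Y → c * Y ≤ a' → a' ≤ C * Y → 0 ≤ a₀ → a₀ ≤ Y ^ κ →
    (∀ φ : F →+* ℂ, (‖φ α‖ = Real.exp a ∧ ‖φ e‖ = Real.exp l) ∨
      (‖φ α‖ ≤ Real.exp (a₀ - a) ∧ ‖φ e‖ = Real.exp (-l))) →
    (∀ φ : F →+* ℂ, (‖φ α'‖ = Real.exp a' ∧ ‖φ e'‖ = Real.exp l') ∨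
      (‖φ α'‖ ≤ Real.exp (a₀ - a') ∧ ‖φ e'‖ = Real.exp (-l'))) →
    (∀ φ : F →+* ℂ, ‖φ r‖ ≤ Real.exp a₀) → (∀ φ : F →+* ℂ, ‖φ r'‖ ≤ Real.exp a₀) →
    0 < ψ r → 0 < ψ r' → |Real.log (ψ r)| ≤ a₀ → |Real.log (ψ r')| ≤ a₀ →
    (∀ i j : ℕ, 0 < i → ψ e ^ i ≠ ψ e' ^ j) →
    ¬ |(a - Real.log (ψ r)) - (a' - Real.log (ψ r'))| ≤ Real.exp (-(c * Y)) := by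
  have q0 := eventually_small_linear_form_false (C := 4 * C + 4) (c := c) (δ := δ) (by linarith) hc hδ hδ1
  have e1 := eventually_const_mul_rpow_le (8 / c) (show δ < 1 - 2 * μ - δ by linarith)
  have e2 := eventually_const_mul_rpow_le (16 / c) (show κ + δ < 1 - 2 * μ - δ by linarith)
  have e3 := eventually_const_mul_rpow_le ((2 + 2 * C / c) * (16 / c))
    (show 2 * μ + 2 * δ < 1 - 2 * μ - δ by linarith)
  have e4 := eventually_const_mul_rpow_le (4 / c) (show 2 * μ + δ < 1 by linarith)
  filter_upwards [q0, e1, e2, e3, e4, eventually_ge_atTop 1] with Y hq0 h1 h2 h3 h4 hY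
  intro F _ _ ψ e e' α α' r r' l l' a a' a₀ hd ie ie1 ie' ie1' iα iα' ir ir' he he' hα hα'
    hl hlΛ hl' hlΛ' ha haC ha' haC' ha₀ ha₀κ hφ hφ' hr hr' pr pr' lr lr' hind hη
  have hY0 : 0 < Y := by linarith
  have hl0 : 0 < l := by linarith
  have hl0' : 0 < l' := by linarith
  have hcY : 0 < c * Y := by positivity
  obtain ⟨iγ, hγ, bγ, γ0, γl⟩ := unit_reduction ψ ie1 iα he hα hl0 (by linarith) ha₀ hφ
  obtain ⟨iγ', hγ', bγ', γ0', γl'⟩ := unit_reduction ψ ie1' iα' he' hα' hl0' (by linarith) ha₀ hφ'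
  have hez := unit_zpow_bounds ψ hl0.le ie ie1 he (fun φ => (hφ φ).imp And.right And.right)
  have hez' := unit_zpow_bounds ψ hl0'.le ie' ie1' he' (fun φ => (hφ' φ).imp And.right And.right)
  have hn2 : a / l < ⌊a / l⌋₊ + 1 := Nat.lt_floor_add_one _
  set n := ⌊a / l⌋₊
  set m := ⌊a' / l'⌋₊
  set γ := α * e⁻¹ ^ n
  set γ' := α' * e'⁻¹ ^ m
  clear_value γ γ' n m
  set Λ := Y ^ μ with hΛ
  have hΛ1 : 1 ≤ Λ := Real.one_le_rpow hY hμ.le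
  have hYδ1 : 1 ≤ Y ^ δ := Real.one_le_rpow hY hδ.le
  have hYδ0 : 0 < Y ^ δ := by linarith
  have hXr : 1 ≤ Λ * Y ^ δ := one_le_mul_of_one_le_of_one_le hΛ1 hYδ1
  obtain ⟨X, hX1, hX2⟩ : ∃ X : ℕ, Λ * Y ^ δ ≤ X ∧ (X : ℝ) ≤ 2 * (Λ * Y ^ δ) :=
    ⟨⌈Λ * Y ^ δ⌉₊, Nat.le_ceil _, by
      have := Nat.ceil_lt_add_one (show 0 ≤ Λ * Y ^ δ by positivity)
      linarith⟩
  have hX0 : (1 : ℝ) ≤ X := hXr.trans hX1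
  have hΛΛ : Λ * Λ * Y ^ δ = Y ^ (2 * μ + δ) := by
    rw [hΛ, ← Real.rpow_add hY0, ← Real.rpow_add hY0]; congr 1; ring
  have hΛΛ2 : Λ * Λ * Y ^ δ * Y ^ δ = Y ^ (2 * μ + 2 * δ) := by
    rw [hΛΛ, ← Real.rpow_add hY0]; congr 1; ring
  have hXΛ : X * Λ ≤ 2 * Y ^ (2 * μ + δ) := by
    rw [← hΛΛ]
    calc X * Λ ≤ 2 * (Λ * Y ^ δ) * Λ := by gcongr
      _ = _ := by ring
  have hnl : c * Y ≤ 2 * (n * l) := by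
    have h5 : a < (n + 1) * l := by rwa [div_lt_iff₀ hl0] at hn2
    have h6 : 4 * Y ^ (2 * μ + δ) ≤ c * Y := by
      rw [Real.rpow_one, div_mul_eq_mul_div, div_le_iff₀ hc] at h4; linarith
    have h7 : Λ ≤ Λ * Λ * Y ^ δ := by
      rw [mul_assoc]; exact le_mul_of_one_le_right (by linarith) hXr
    linarith
  have hnX : X ≤ (n : ℝ) := by
    have h6 : 4 * Y ^ (2 * μ + δ) ≤ c * Y := by
      rw [Real.rpow_one, div_mul_eq_mul_div, div_le_iff₀ hc] at h4; linarith
    have h8 : X * Λ ≤ n * Λ := by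
      have : (n : ℝ) * l ≤ n * Λ := by gcongr
      linarith
    exact le_of_mul_le_mul_right h8 (by linarith)
  have hn1 : (1 : ℝ) ≤ n := hX0.trans hnX
  have hn0' : (0 : ℝ) < n := by linarith
  obtain ⟨jz, kz, hk0, hkX, hjk⟩ := Real.exists_int_int_abs_mul_sub_le ((m : ℝ) / n)
    (show 0 < X by exact_mod_cast (by linarith : (0:ℝ) < X))
  have hρ0 : 0 ≤ (m : ℝ) / n := by positivity
  have hX1' : (1 : ℝ) / (X + 1) ≤ 1 / X := by gcongr; linarith
  have hj0 : 0 ≤ jz := by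
    have h5 : (0 : ℝ) < kz := by exact_mod_cast hk0
    have h6 : 1 / ((X : ℝ) + 1) < 1 := by rw [div_lt_one (by linarith)]; linarith
    have h7 := (abs_le.mp hjk).2
    have h8 : (-1 : ℝ) < jz := by
      have : 0 ≤ kz * ((m : ℝ) / n) := by positivity
      linarith
    have : -1 < jz := by exact_mod_cast h8
    omega
  obtain ⟨j, rfl⟩ := Int.eq_ofNat_of_zero_le hj0
  obtain ⟨k, rfl⟩ := Int.eq_ofNat_of_zero_le hk0.le
  simp only [Int.cast_natCast] at hjk
  have hk : 0 < k := by exact_mod_cast hk0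
  have hkX' : k ≤ X := by exact_mod_cast hkX
  have hkn : k ≤ n := hkX'.trans (by exact_mod_cast hnX)
  set q := n / k with hq
  set n₀ := n % k with hn₀
  have hnqk : n = n₀ + q * k := by rw [hq, hn₀, mul_comm]; exact (Nat.mod_add_div n k).symm
  have hn₀k : n₀ < k := Nat.mod_lt _ hk
  have hq1 : 1 ≤ q := (Nat.one_le_div_iff hk).mpr hkn
  clear_value q n₀
  have hq1' : (1 : ℝ) ≤ q := by exact_mod_cast hq1
  have hk1' : (1 : ℝ) ≤ k := by exact_mod_cast hk
  have hkXr : (k : ℝ) ≤ X := by exact_mod_cast hkX'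
  have hn₀kr : (n₀ : ℝ) ≤ k := by exact_mod_cast hn₀k.le
  have hnqkr : (n : ℝ) = n₀ + q * k := by rw [hnqk]; push_cast; ring
  have hqk2 : (n : ℝ) ≤ 2 * (q * k) := by
    have : (k : ℝ) ≤ q * k := le_mul_of_one_le_left (by linarith) hq1'
    linarith
  have hqkn : (q * k : ℝ) ≤ n := by
    have : (0 : ℝ) ≤ n₀ := by positivity
    linarith
  have hqlow : c / 8 * Y ^ (1 - 2 * μ - δ) ≤ q := by
    have h5 : c * Y ≤ q * (8 * Y ^ (2 * μ + δ)) := by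
      calc c * Y ≤ 2 * (n * l) := hnl
        _ ≤ 2 * ((2 * (q * k)) * l) := by gcongr
        _ ≤ 2 * ((2 * (q * X)) * Λ) := by gcongr
        _ = 4 * q * (X * Λ) := by ring
        _ ≤ 4 * q * (2 * Y ^ (2 * μ + δ)) := by gcongr
        _ = _ := by ring
    have h6 : Y = Y ^ (1 - 2 * μ - δ) * Y ^ (2 * μ + δ) := by
      rw [← Real.rpow_add hY0]; ring_nf; exact (Real.rpow_one Y).symm
    have h7 : 0 < Y ^ (2 * μ + δ) := by positivity
    refine le_of_mul_le_mul_right ?_ h7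
    rw [mul_assoc, ← h6]; linarith
  have hnlC : n * l ≤ C * Y := by linarith
  have hmlC : m * l' ≤ C * Y := by linarith
  have hqC : (q : ℝ) ≤ 2 * (C * Y) := by
    have h5 : (q : ℝ) ≤ q * k := le_mul_of_one_le_right (by linarith) hk1'
    have h6 : (n : ℝ) * (1 / 2) ≤ n * l := by gcongr
    linarith
  have hq0r : (0 : ℝ) < q := by linarith
  have hlX : l' / X ≤ 1 / Y ^ δ := by
    rw [div_le_div_iff₀ (by linarith) hYδ0]
    calc l' * Y ^ δ ≤ Λ * Y ^ δ := by gcongr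
      _ ≤ 1 * X := by rw [one_mul]; exact hX1
  have hjk' := abs_le.mp (hjk.trans hX1')
  set m₀ : ℤ := m - q * j with hm₀
  have hm₀r : (m₀ : ℝ) = m - q * j := by rw [hm₀]; push_cast; ring
  have hm₀eq : (m₀ : ℝ) = q * (k * (m / n) - j) + m / n * n₀ := by
    have h5 : (m : ℝ) = m / n * n := by field_simp
    have h6 : (m : ℝ) / n * n = m / n * (n₀ + q * k) := by rw [← hnqkr]
    rw [hm₀r]
    linarith
  clear_value m₀
  have hρl : (m : ℝ) / n * l' ≤ 2 * C / c * Λ := by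
    calc (m : ℝ) / n * l' = m * l' / n := by ring
      _ ≤ C * Y / n := by gcongr
      _ ≤ 2 * C / c * l := by
          rw [div_le_iff₀ hn0']
          calc C * Y = C / c * (c * Y) := by field_simp
            _ ≤ C / c * (2 * (n * l)) := by gcongr
            _ = _ := by ring
      _ ≤ _ := by gcongr
  have hm₀b : |(m₀ : ℝ)| * l' ≤ q / Y ^ δ + 2 * C / c * (X * Λ) := by
    calc |(m₀ : ℝ)| * l' ≤ (q * (1 / X) + m / n * n₀) * l' := by
          gcongr
          rw [hm₀eq]
          refine (abs_add_le _ _).trans (add_le_add ?_ ?_)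
          · rw [abs_mul, abs_of_pos hq0r]; gcongr; exact hjk.trans hX1'
          · rw [abs_of_nonneg (by positivity)]
      _ = q * (l' / X) + m / n * l' * n₀ := by ring
      _ ≤ q * (1 / Y ^ δ) + 2 * C / c * Λ * X := by
          gcongr
          exact_mod_cast hn₀kr.trans hkXr
      _ = _ := by ring
  have hn₀b : |((n₀ : ℤ) : ℝ)| * l ≤ X * Λ := by
    rw [Int.cast_natCast, Nat.abs_cast]
    exact mul_le_mul (hn₀kr.trans hkXr) hlΛ hl0.le (by linarith)
  have hΛX : Λ ≤ X * Λ := le_mul_of_one_le_left (by linarith) hX0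
  set hb : ℝ := 2 * a₀ + q / Y ^ δ + (2 + 2 * C / c) * (X * Λ) with hhb
  have hCc : 0 < 2 * C / c := by positivity
  have hXΛ0 : 0 < X * Λ := by linarith
  have hqY0 : 0 < q / Y ^ δ := by positivity
  have hb1 : a₀ + l' + a₀ + |(m₀ : ℝ)| * l' ≤ hb := by rw [hhb]; linarith
  have hb2 : a₀ + l + a₀ + |((n₀ : ℤ) : ℝ)| * l ≤ hb := by
    rw [hhb]
    have := mul_pos hCc hXΛ0
    linarith
  clear_value hb
  have hqδ : Y ^ δ ≤ q := by
    refine le_trans ?_ hqlow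
    rw [div_mul_eq_mul_div, le_div_iff₀ (by norm_num : (0:ℝ) < 8), mul_comm]
    rw [div_mul_eq_mul_div, div_le_iff₀ hc] at h1; linarith
  have hbq : hb * Y ^ δ ≤ (4 * C + 4) * q := by
    have h5 : 2 * a₀ * Y ^ δ ≤ q := by
      refine le_trans ?_ hqlow
      have : a₀ * Y ^ δ ≤ Y ^ (κ + δ) := by rw [Real.rpow_add hY0]; gcongr
      rw [div_mul_eq_mul_div, div_le_iff₀ hc] at h2; linarith
    have h6 : (2 + 2 * C / c) * (X * Λ) * Y ^ δ ≤ q := by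
      have h7 : X * Λ * Y ^ δ ≤ 2 * Y ^ (2 * μ + 2 * δ) := by
        rw [← hΛΛ2, hΛΛ, ← mul_assoc]; gcongr
      have h8 : (2 + 2 * C / c) * (2 * Y ^ (2 * μ + 2 * δ)) ≤ c / 8 * Y ^ (1 - 2 * μ - δ) := by
        calc _ = c / 8 * ((2 + 2 * C / c) * (16 / c) * Y ^ (2 * μ + 2 * δ)) := by field_simp; norm_num
          _ ≤ _ := by gcongr
      calc _ = (2 + 2 * C / c) * (X * Λ * Y ^ δ) := by ring
        _ ≤ (2 + 2 * C / c) * (2 * Y ^ (2 * μ + 2 * δ)) := by gcongr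
        _ ≤ _ := h8.trans hqlow
    have h9 : q / Y ^ δ * Y ^ δ = q := by field_simp
    have h10 : (q : ℝ) ≤ C * q := le_mul_of_one_le_left hq0r.le hC
    calc hb * Y ^ δ = 2 * a₀ * Y ^ δ + q / Y ^ δ * Y ^ δ + (2 + 2 * C / c) * (X * Λ) * Y ^ δ := by
          rw [hhb]; ring
      _ ≤ _ := by rw [h9]; linarith
  have hb0 : 0 < hb := by
    have := mul_pos hCc hXΛ0
    rw [hhb]; linarith
  obtain ⟨i1, p1, s1⟩ := hez' m₀
  obtain ⟨i2, p2, s2⟩ := hez n₀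
  obtain ⟨i3, p3, s3⟩ := hez k
  obtain ⟨i4, p4, s4⟩ := hez' (-(j : ℤ))
  have lr1 := abs_le.mp lr
  have lr2 := abs_le.mp lr'
  have hm₀up : (m₀ : ℝ) * l' ≤ |(m₀ : ℝ)| * l' := by gcongr; exact le_abs_self _
  have hm₀lo : -(|(m₀ : ℝ)| * l') ≤ (m₀ : ℝ) * l' := by
    rw [← neg_mul]; gcongr; exact neg_abs_le _
  have hn₀abs : 0 ≤ (n₀ : ℝ) * l := by positivity
  simp only [Int.cast_natCast, Nat.abs_cast, Int.cast_neg, abs_neg] at *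
  have L1 : Real.log (ψ (γ' * r * e' ^ m₀)) = (a' - m * l') + Real.log (ψ r) + m₀ * l' := by
    rw [map_mul, map_mul, p1, hγ', Real.log_mul (by positivity) (by positivity),
      Real.log_mul (by positivity) (by positivity), Real.log_exp, Real.log_exp]
  have L2 : Real.log (ψ (γ * r' * e ^ (n₀ : ℤ))) = (a - n * l) + Real.log (ψ r') + n₀ * l := by
    rw [map_mul, map_mul, p2, hγ, Real.log_mul (by positivity) (by positivity),
      Real.log_mul (by positivity) (by positivity), Real.log_exp, Real.log_exp]
  have P1 : 0 < ψ (γ' * r * e' ^ m₀) := by rw [map_mul, map_mul, p1, hγ']; positivity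
  have P2 : 0 < ψ (γ * r' * e ^ (n₀ : ℤ)) := by rw [map_mul, map_mul, p2, hγ]; positivity
  have PW : ψ (e ^ (k : ℤ) * e' ^ (-(j : ℤ))) = Real.exp (k * l - j * l') := by
    rw [map_mul, p3, p4, ← Real.exp_add]; congr 1; ring
  refine hq0 F ψ (e ^ (k : ℤ) * e' ^ (-(j : ℤ))) (γ' * r * e' ^ m₀) (γ * r' * e ^ (n₀ : ℤ))
    (k * l + j * l') hb q hd (i3.mul i4) ((iγ'.mul ir).mul i1) ((iγ.mul ir').mul i2)
    (by positivity) hb0 ?_ ?_ ?_ ?_ ?_ P1 P2 ?_ hbq ?_ ?_ hqδ ?_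
  · intro φ
    rw [map_mul, norm_mul, Real.exp_add]
    exact mul_le_mul (s3 φ) (s4 φ) (norm_nonneg _) (Real.exp_pos _).le
  · intro φ
    rw [map_mul, map_mul, norm_mul, norm_mul]
    calc _ ≤ Real.exp (a₀ + l') * Real.exp a₀ * Real.exp (|(m₀ : ℝ)| * l') := by
          gcongr
          exacts [bγ' φ, hr φ, s1 φ]
      _ = Real.exp (a₀ + l' + a₀ + |(m₀ : ℝ)| * l') := by rw [← Real.exp_add, ← Real.exp_add]
      _ ≤ _ := Real.exp_le_exp.mpr hb1
  · intro φ
    rw [map_mul, map_mul, norm_mul, norm_mul]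
    calc _ ≤ Real.exp (a₀ + l) * Real.exp a₀ * Real.exp (n₀ * l) := by
          gcongr
          exacts [bγ φ, hr' φ, s2 φ]
      _ = Real.exp (a₀ + l + a₀ + n₀ * l) := by rw [← Real.exp_add, ← Real.exp_add]
      _ ≤ _ := Real.exp_le_exp.mpr hb2
  · rw [PW]; exact Real.exp_pos _
  · rw [PW]
    intro h
    rw [Real.exp_eq_one_iff, sub_eq_zero] at h
    refine hind k j hk ?_
    rw [he, he', ← Real.exp_nat_mul, ← Real.exp_nat_mul, h]
  · rw [Real.log_div P1.ne' P2.ne', L1, L2, abs_le]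
    constructor <;> linarith
  · have h5 : j * q * l' ≤ C * Y + q := by
      have h6 : (j : ℝ) ≤ k * (m / n) + 1 / X := by linarith [hjk'.1]
      have h7 : k * q * ((m : ℝ) / n) ≤ m := by
        calc k * q * ((m : ℝ) / n) = q * k * (m / n) := by ring
          _ ≤ n * (m / n) := by gcongr
          _ = m := by field_simp
      have h8 : l' / X ≤ 1 := hlX.trans (by rw [div_le_one hYδ0]; exact hYδ1)
      calc j * q * l' ≤ (k * (m / n) + 1 / X) * q * l' := by gcongr
        _ = k * q * (m / n) * l' + q * (l' / X) := by ring
        _ ≤ m * l' + q * 1 := by gcongr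
        _ ≤ _ := by linarith
    have h9 : q * k * l ≤ n * l := by gcongr
    calc (k * l + j * l') * q = q * k * l + j * q * l' := by ring
      _ ≤ _ := by linarith
  · have : 0 < C * Y := by positivity
    linarith
  · rw [PW, Real.log_exp, Real.log_div P1.ne' P2.ne', L1, L2]
    have h5 : k * l - j * l' - ((a' - m * l') + Real.log (ψ r) + m₀ * l' -
        ((a - n * l) + Real.log (ψ r') + n₀ * l)) / q =
        ((a - Real.log (ψ r)) - (a' - Real.log (ψ r'))) / q := by
      rw [eq_div_iff hq0r.ne', sub_mul, div_mul_cancel₀ _ hq0r.ne', hm₀r, hnqkr]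
      ring
    rw [h5, abs_div, abs_of_pos hq0r]
    exact (div_le_self (abs_nonneg _) hq1').trans hη

theorem exists_residue_of_isCoprime {a b D n : ℤ} (hab : IsCoprime a b) (hn : n = a ^ 2 - D * b ^ 2)
    (hn0 : n ≠ 0) : ∃ t : ℕ, t < n.natAbs ∧ n ∣ (t : ℤ) ^ 2 - D ∧ n ∣ a - t * b := by
  have hbn : IsCoprime b n := by
    rw [hn, show a ^ 2 - D * b ^ 2 = a ^ 2 + b * (-(D * b)) by ring]
    exact (IsCoprime.add_mul_left_right (hab.symm.pow_right (n := 2)) _)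
  obtain ⟨u, v, huv⟩ := hbn
  have ht0 : 0 ≤ (a * u) % n := Int.emod_nonneg _ hn0
  have hmod : n ∣ a * u - (a * u) % n := Int.dvd_self_sub_emod
  have h2 : n ∣ a - (a * u) % n * b := by
    have : a - (a * u) % n * b = (a * u - (a * u) % n) * b + n * (a * v) := by
      linear_combination a * huv.symm
    rw [this]
    exact dvd_add (hmod.mul_right _) (dvd_mul_right _ _)
  have h1 : n ∣ ((a * u) % n) ^ 2 - D := by
    have h3 : n ∣ b ^ 2 * (((a * u) % n) ^ 2 - D) := by
      have : b ^ 2 * (((a * u) % n) ^ 2 - D) =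
          n - (a - (a * u) % n * b) * (a + (a * u) % n * b) := by rw [hn]; ring
      rw [this]
      exact dvd_sub dvd_rfl (h2.mul_right _)
    exact (IsCoprime.pow_right (n := 2) ⟨v, u, by linear_combination huv⟩ : IsCoprime n (b ^ 2)).dvd_of_dvd_mul_left h3
  refine ⟨((a * u) % n).toNat, ?_, ?_, ?_⟩
  · have := Int.emod_lt (a * u) hn0
    omega
  · rwa [Int.toNat_of_nonneg ht0]
  · rwa [Int.toNat_of_nonneg ht0]

theorem exists_pell_of_same_class {a b a' b' D n t : ℤ} (hab : IsCoprime a b) (hab' : IsCoprime a' b')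
    (hb : 0 < b) (hb' : 0 < b') (hn : n = a ^ 2 - D * b ^ 2) (hn' : n = a' ^ 2 - D * b' ^ 2)
    (hn0 : n ≠ 0) (ht : n ∣ t ^ 2 - D) (h : n ∣ a - t * b) (h' : n ∣ a' - t * b')
    (hne : (a, b) ≠ (a', b')) :
    ∃ x y : ℤ, x ^ 2 - D * y ^ 2 = 1 ∧ y ≠ 0 ∧ n * x = a * a' - D * (b * b') ∧
      n * y = a' * b - a * b' := by
  obtain ⟨x, hx⟩ : n ∣ a * a' - D * (b * b') := by
    have : a * a' - D * (b * b') = (a - t * b) * a' + t * b * (a' - t * b') + (t ^ 2 - D) * (b * b') := by ring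
    rw [this]
    exact dvd_add (dvd_add (h.mul_right _) (h'.mul_left _)) (ht.mul_right _)
  obtain ⟨y, hy⟩ : n ∣ a' * b - a * b' := by
    have : a' * b - a * b' = (a' - t * b') * b - (a - t * b) * b' := by ring
    rw [this]
    exact dvd_sub (h'.mul_right _) (h.mul_right _)
  refine ⟨x, y, ?_, ?_, hx.symm, hy.symm⟩
  · have : n ^ 2 * (x ^ 2 - D * y ^ 2) = n ^ 2 * 1 := by
      calc _ = (n * x) ^ 2 - D * (n * y) ^ 2 := by ring
        _ = (a ^ 2 - D * b ^ 2) * (a' ^ 2 - D * b' ^ 2) := by rw [← hx, ← hy]; ring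
        _ = _ := by rw [← hn, ← hn']; ring
    exact mul_left_cancel₀ (pow_ne_zero 2 hn0) this
  · rintro rfl
    apply hne
    have hcross : a' * b = a * b' := by linarith
    have d1 : b ∣ b' := hab.symm.dvd_of_dvd_mul_left ⟨a', by linarith⟩
    have d2 : b' ∣ b := hab'.symm.dvd_of_dvd_mul_left ⟨a, by linarith⟩
    have hbb : b = b' := Int.dvd_antisymm hb.le hb'.le d1 d2
    subst hbb
    have : a' = a := mul_right_cancel₀ hb.ne' hcross
    rw [this]

theorem exists_pell_le_of_card {D : ℕ} (hD : ¬ IsSquare D) {N₀ M : ℕ}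
    (hN₀ : 2 * Real.sqrt D + 1 < N₀ + 1)
    (hM : 2 * ∑ t ∈ Finset.range N₀, (((t : ℤ) ^ 2 - D).natAbs.divisors).card ≤ M) :
    ∃ x y : ℕ, 0 < y ∧ x ^ 2 = D * y ^ 2 + 1 ∧
      Real.log (x + y * Real.sqrt D) ≤ 2 * (M + 1) * Real.log (3 * D) := by
  classical
  set s := Real.sqrt D with hs
  have hD2 : 2 ≤ D := by
    by_contra h
    have : D = 0 ∨ D = 1 := by omega
    rcases this with rfl | rfl
    · exact hD ⟨0, rfl⟩
    · exact hD ⟨1, rfl⟩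
  have hD2' : (2 : ℝ) ≤ D := by exact_mod_cast hD2
  have hs2 : s ^ 2 = D := Real.sq_sqrt (by positivity)
  have hs1 : 1 ≤ s := by rw [hs, Real.one_le_sqrt]; linarith
  have hsD : s ≤ D := by nlinarith
  have hnorm0 : ∀ a b : ℤ, 0 < b → a ^ 2 - D * b ^ 2 ≠ 0 := by
    intro a b hb h
    apply hD
    have h1 : (b : ℤ) ^ 2 ∣ a ^ 2 := ⟨D, by linarith⟩
    obtain ⟨c, rfl⟩ := (Int.pow_dvd_pow_iff two_ne_zero).mp h1
    have h2 : b ^ 2 * (c ^ 2) = b ^ 2 * D := by linarith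
    have h3 := mul_left_cancel₀ (pow_ne_zero 2 hb.ne') h2
    refine ⟨c.natAbs, ?_⟩
    zify
    rw [← h3, ← pow_two, sq_abs]
  have happ : ∀ j : ℕ, ∃ ab : ℤ × ℤ, IsCoprime ab.1 ab.2 ∧ 0 < ab.2 ∧ ab.2 ≤ (3 * D : ℤ) ^ j ∧
      |ab.1 - ab.2 * s| < 1 / (3 * D : ℝ) ^ j := by
    intro j
    have hpos : 0 < (3 * D) ^ j := by positivity
    obtain ⟨r, hr1, hr2⟩ := Real.exists_rat_abs_sub_le_and_den_le s hpos
    refine ⟨(r.num, r.den), ?_, ?_, ?_, ?_⟩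
    rotate_left
    · show (0 : ℤ) < (r.den : ℤ)
      exact_mod_cast r.pos
    · show (r.den : ℤ) ≤ (3 * D : ℤ) ^ j
      exact_mod_cast hr2
    rotate_left
    · rw [Int.isCoprime_iff_gcd_eq_one, Int.gcd]; simpa using r.reduced
    · have hden : (0 : ℝ) < r.den := by exact_mod_cast r.pos
      have h1 : ((r.num : ℤ) : ℝ) - ((r.den : ℤ) : ℝ) * s = -(r.den * (s - r)) := by
        have : (r : ℝ) = r.num / r.den := by exact_mod_cast (Rat.num_div_den r).symm
        rw [this]; push_cast; field_simp; ring
      simp only [h1, abs_neg, abs_mul, Nat.abs_cast]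
      push_cast at hr1
      calc (r.den : ℝ) * |s - r| ≤ r.den * (1 / (((3 * D : ℝ) ^ j + 1) * r.den)) := by gcongr
        _ = 1 / ((3 * D : ℝ) ^ j + 1) := by field_simp
        _ < _ := by gcongr; linarith
  choose f hcop hbpos hbQ hclose using happ
  have hQ1 : ∀ j : ℕ, (1 : ℝ) ≤ (3 * D : ℝ) ^ j := fun j => one_le_pow₀ (by linarith)
  have hclose1 : ∀ j, |(f j).1 - (f j).2 * s| < 1 := fun j =>
    (hclose j).trans_le (div_le_one_of_le₀ (hQ1 j) (by linarith [hQ1 j]))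
  have hb1 : ∀ j, (1 : ℝ) ≤ (f j).2 := fun j => by exact_mod_cast hbpos j
  have hbQ' : ∀ j, ((f j).2 : ℝ) ≤ (3 * D : ℝ) ^ j := fun j => by exact_mod_cast hbQ j
  have hconj : ∀ j, |((f j).1 : ℝ) + (f j).2 * s| ≤ 2 * ((f j).2 * s) + 1 := by
    intro j
    have h1 := abs_lt.mp (hclose1 j)
    have h2 : 0 ≤ (f j).2 * s := mul_nonneg (by linarith [hb1 j]) (by linarith)
    rw [abs_le]; constructor <;> linarith
  have hbs1 : ∀ j, 1 ≤ (f j).2 * s := fun j => one_le_mul_of_one_le_of_one_le (hb1 j) hs1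
  set nm : ℕ → ℤ := fun j => (f j).1 ^ 2 - D * (f j).2 ^ 2 with hnm
  have hnm0 : ∀ j, nm j ≠ 0 := fun j => hnorm0 _ _ (hbpos j)
  have hnmr : ∀ j, ((nm j : ℤ) : ℝ) = ((f j).1 - (f j).2 * s) * ((f j).1 + (f j).2 * s) := by
    intro j; simp only [hnm]; push_cast; rw [← hs2]; ring
  have hnmabs : ∀ j, (1 : ℝ) ≤ |((f j).1 : ℝ) - (f j).2 * s| * |((f j).1 : ℝ) + (f j).2 * s| := by
    intro j
    rw [← abs_mul, ← hnmr, ← Int.cast_abs]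
    exact_mod_cast Int.one_le_abs (hnm0 j)
  have hinj : ∀ i j, i < j → f i ≠ f j := by
    intro i j hij h
    have h1 := hnmabs i
    have h2 := hclose j
    rw [← h] at h2
    have hQi := hQ1 i
    have h3 : |((f i).1 : ℝ) + (f i).2 * s| ≤ 3 * ((f i).2 * s) := by
      linarith [hconj i, hbs1 i]
    have h4 : 3 * ((f i).2 * s) ≤ (3 * D : ℝ) ^ j := by
      calc 3 * ((f i).2 * s) ≤ 3 * ((3 * D : ℝ) ^ i * D) := by
            gcongr
            exact hbQ' i
        _ = (3 * D : ℝ) ^ (i + 1) := by ring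
        _ ≤ _ := pow_le_pow_right₀ (by linarith) hij
    have hQj := hQ1 j
    have : |((f i).1 : ℝ) - (f i).2 * s| * |((f i).1 : ℝ) + (f i).2 * s| < 1 / (3 * D : ℝ) ^ j * (3 * D : ℝ) ^ j := by
      refine mul_lt_mul'' h2 (lt_of_lt_of_le ?_ le_rfl) (abs_nonneg _) (abs_nonneg _) |>.trans_le le_rfl
      refine lt_of_le_of_ne (h3.trans h4) ?_
      intro heq
      have h5 : 2 * ((f i).2 * s) + 1 = 3 * ((f i).2 * s) := by linarith [hconj i, hbs1 i]
      have h6 : s ≤ 1 := by nlinarith [hb1 i, hbs1 i]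
      nlinarith
    rw [one_div, inv_mul_cancel₀ (by linarith)] at this
    linarith
  have hnmle : ∀ j, (nm j).natAbs ≤ N₀ := by
    intro j
    have h1 : ((nm j).natAbs : ℝ) ≤ 2 * s + 1 := by
      rw [Nat.cast_natAbs, Int.cast_abs, hnmr, abs_mul]
      have h2 : |((f j).1 : ℝ) - (f j).2 * s| ≤ 1 / (f j).2 :=
        (hclose j).le.trans (one_div_le_one_div_of_le (by linarith [hb1 j]) (hbQ' j))
      have hb0 : (0 : ℝ) < (f j).2 := by linarith [hb1 j]
      calc _ ≤ 1 / ((f j).2 : ℝ) * (2 * ((f j).2 * s) + 1) := by gcongr; exact hconj j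
        _ = 2 * s + 1 / (f j).2 := by field_simp
        _ ≤ _ := by gcongr; exact div_le_one_of_le₀ (hb1 j) hb0.le
    have : ((nm j).natAbs : ℝ) < N₀ + 1 := by linarith
    have : (nm j).natAbs < N₀ + 1 := by exact_mod_cast this
    omega
  choose t ht1 ht2 ht3 using fun j => exists_residue_of_isCoprime (hcop j) (rfl : nm j = _) (hnm0 j)
  let S : Finset ((Σ _ : ℕ, ℕ) × Bool) :=
    ((Finset.range N₀).sigma fun t => ((t : ℤ) ^ 2 - D).natAbs.divisors) ×ˢ Finset.univ
  have hScard : S.card ≤ M := by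
    rw [Finset.card_product, Finset.card_sigma]
    simpa [mul_comm] using hM
  let cls : ℕ → (Σ _ : ℕ, ℕ) × Bool := fun j => (⟨t j, (nm j).natAbs⟩, decide (0 < nm j))
  have hmaps : ∀ j ∈ Finset.range (M + 1), cls j ∈ S := by
    intro j _
    simp only [cls, S, Finset.mem_product, Finset.mem_sigma, Finset.mem_range, Nat.mem_divisors,
      Finset.mem_univ, and_true]
    refine ⟨(ht1 j).trans_le (hnmle j), Int.natAbs_dvd_natAbs.mpr (ht2 j), ?_⟩
    intro h
    have h1 : (t j : ℤ) ^ 2 - D = 0 := Int.natAbs_eq_zero.mp h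
    apply hD
    refine ⟨t j, ?_⟩
    zify
    linarith
  obtain ⟨i, hi, j, hj, hij, hcls⟩ := Finset.exists_ne_map_eq_of_card_lt_of_maps_to
    (by rw [Finset.card_range]; omega) hmaps
  have hfij : f i ≠ f j := by
    rcases lt_or_gt_of_ne hij with h | h
    · exact hinj i j h
    · exact (hinj j i h).symm
  simp only [cls, Prod.mk.injEq, Sigma.mk.injEq, heq_eq_eq, decide_eq_decide] at hcls
  obtain ⟨⟨htt, hnn⟩, hsgn⟩ := hcls
  have hnij : nm i = nm j := by
    have := hnm0 i; have := hnm0 j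
    omega
  obtain ⟨x, y, hxy, hy0, hx, hy⟩ := exists_pell_of_same_class (D := D) (hcop i) (hcop j) (hbpos i) (hbpos j)
    (rfl : nm i = _) hnij (hnm0 i) (ht2 i) (ht3 i) (by rw [htt, hnij]; exact ht3 j)
    (by simpa using hfij)
  refine ⟨x.natAbs, y.natAbs, Int.natAbs_pos.mpr hy0, ?_, ?_⟩
  · zify; rw [sq_abs, sq_abs]; linarith
  · have hbound : ∀ k ∈ Finset.range (M + 1), |((f k).1 : ℝ)| + (f k).2 * s ≤ (3 * D : ℝ) ^ (M + 1) := by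
      intro k hk
      have h1 := abs_lt.mp (hclose1 k)
      have h2 : |((f k).1 : ℝ)| ≤ (f k).2 * s + 1 := by
        have := hbs1 k
        rw [abs_le]; constructor <;> linarith
      calc _ ≤ 3 * ((f k).2 * s) := by linarith [hbs1 k]
        _ ≤ 3 * ((3 * D : ℝ) ^ k * D) := by gcongr; exact hbQ' k
        _ = (3 * D : ℝ) ^ (k + 1) := by ring
        _ ≤ _ := pow_le_pow_right₀ (by linarith) (Finset.mem_range.mp hk)
    have hn1 : (1 : ℝ) ≤ |(nm i : ℝ)| := by
      rw [← Int.cast_abs]; exact_mod_cast Int.one_le_abs (hnm0 i)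
    have hxr : (nm i : ℝ) * x = (f i).1 * (f j).1 - D * ((f i).2 * (f j).2) := by exact_mod_cast hx
    have hyr : (nm i : ℝ) * y = (f j).1 * (f i).2 - (f i).1 * (f j).2 := by exact_mod_cast hy
    have hbi := hb1 i
    have hbj := hb1 j
    have hx2 : |(x : ℝ)| ≤ |((f i).1 : ℝ)| * |((f j).1 : ℝ)| + D * ((f i).2 * (f j).2) := by
      calc |(x : ℝ)| ≤ |(nm i : ℝ)| * |(x : ℝ)| := le_mul_of_one_le_left (abs_nonneg _) hn1
        _ = |((f i).1 : ℝ) * (f j).1 - D * ((f i).2 * (f j).2)| := by rw [← abs_mul, hxr]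
        _ ≤ _ := (abs_sub _ _).trans (by
            rw [abs_mul, abs_of_nonneg (by positivity : (0 : ℝ) ≤ D * ((f i).2 * (f j).2))])
    have hy2 : |(y : ℝ)| ≤ |((f j).1 : ℝ)| * (f i).2 + |((f i).1 : ℝ)| * (f j).2 := by
      calc |(y : ℝ)| ≤ |(nm i : ℝ)| * |(y : ℝ)| := le_mul_of_one_le_left (abs_nonneg _) hn1
        _ = |((f j).1 : ℝ) * (f i).2 - (f i).1 * (f j).2| := by rw [← abs_mul, hyr]
        _ ≤ _ := (abs_sub _ _).trans (by
            rw [abs_mul, abs_mul, abs_of_nonneg (by linarith : (0 : ℝ) ≤ (f i).2),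
              abs_of_nonneg (by linarith : (0 : ℝ) ≤ (f j).2)])
    have hsum : |(x : ℝ)| + |(y : ℝ)| * s ≤ ((3 * D : ℝ) ^ (M + 1)) ^ 2 := by
      calc _ ≤ (|((f i).1 : ℝ)| * |((f j).1 : ℝ)| + D * ((f i).2 * (f j).2)) +
            (|((f j).1 : ℝ)| * (f i).2 + |((f i).1 : ℝ)| * (f j).2) * s := by gcongr
        _ = (|((f i).1 : ℝ)| + (f i).2 * s) * (|((f j).1 : ℝ)| + (f j).2 * s) := by
            rw [← hs2]; ring
        _ ≤ (3 * D : ℝ) ^ (M + 1) * (3 * D : ℝ) ^ (M + 1) := by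
            gcongr
            · exact hbound i hi
            · exact hbound j hj
        _ = _ := by ring
    have hypos : 0 < |(y : ℝ)| := abs_pos.mpr (by exact_mod_cast hy0)
    rw [Nat.cast_natAbs, Nat.cast_natAbs, Int.cast_abs, Int.cast_abs]
    calc Real.log (|(x : ℝ)| + |(y : ℝ)| * s) ≤ Real.log (((3 * D : ℝ) ^ (M + 1)) ^ 2) :=
          Real.log_le_log (by positivity) hsum
      _ = _ := by rw [← pow_mul, Real.log_pow]; push_cast; ring

/-- The Pell equation has a solution of logarithmic size at most `C * D ^ (1 / 2 + δ)`. -/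
theorem exists_pell_log_le (δ : ℝ) (hδ : 0 < δ) : ∃ C : ℝ, 1 ≤ C ∧ ∀ D : ℕ, ¬ IsSquare D →
    ∃ x y : ℕ, 0 < y ∧ x ^ 2 = D * y ^ 2 + 1 ∧
      Real.log (x + y * Real.sqrt D) ≤ C * (D : ℝ) ^ (1 / 2 + δ) := by
  obtain ⟨K, hK1, hK⟩ := card_divisors_le_rpow (δ / 2) (by linarith)
  refine ⟨2 * (6 * (K * 16 ^ (δ / 2)) + 1) * (3 ^ (δ / 2) / (δ / 2)) + 1, ?_, ?_⟩
  · have : 0 ≤ 2 * (6 * (K * (16 : ℝ) ^ (δ / 2)) + 1) * (3 ^ (δ / 2) / (δ / 2)) := by positivity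
    linarith
  intro D hD
  have hD2 : 2 ≤ D := by
    by_contra h
    have : D = 0 ∨ D = 1 := by omega
    rcases this with rfl | rfl
    · exact hD ⟨0, rfl⟩
    · exact hD ⟨1, rfl⟩
  have hD2' : (2 : ℝ) ≤ D := by exact_mod_cast hD2
  set s := Real.sqrt D with hs
  have hs2 : s ^ 2 = D := Real.sq_sqrt (by positivity)
  have hs1 : 1 ≤ s := by rw [hs, Real.one_le_sqrt]; linarith
  set N₀ := ⌊2 * s + 1⌋₊ with hN₀
  have hN₀lt : 2 * s + 1 < N₀ + 1 := Nat.lt_floor_add_one _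
  have hN₀le : (N₀ : ℝ) ≤ 3 * s := (Nat.floor_le (by positivity)).trans (by linarith)
  have hterm : ∀ t ∈ Finset.range N₀,
      ((((t : ℤ) ^ 2 - D).natAbs.divisors.card : ℕ) : ℝ) ≤ K * 16 ^ (δ / 2) * (D : ℝ) ^ (δ / 2) := by
    intro t ht
    have h0 : ((t : ℤ) ^ 2 - D).natAbs ≠ 0 := by
      intro h
      have h1 : (t : ℤ) ^ 2 - D = 0 := Int.natAbs_eq_zero.mp h
      apply hD
      refine ⟨t, ?_⟩
      zify
      linarith
    have htN : (t : ℝ) < N₀ := by exact_mod_cast Finset.mem_range.mp ht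
    have ht3 : (t : ℝ) ≤ 3 * s := by linarith
    have ht2 : (t : ℝ) ^ 2 ≤ 9 * (D : ℝ) := by
      have h1 : (t : ℝ) ^ 2 ≤ (3 * s) ^ 2 := pow_le_pow_left₀ (Nat.cast_nonneg _) ht3 2
      linarith [h1, mul_pow 3 s 2]
    have hle : ((((t : ℤ) ^ 2 - D).natAbs : ℕ) : ℝ) ≤ 16 * D := by
      rw [Nat.cast_natAbs, Int.cast_abs]
      push_cast
      rw [abs_le]
      constructor <;> nlinarith [sq_nonneg (t : ℝ)]
    calc _ ≤ K * ((((t : ℤ) ^ 2 - D).natAbs : ℕ) : ℝ) ^ (δ / 2) := hK _ h0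
      _ ≤ K * (16 * D) ^ (δ / 2) := by gcongr
      _ = _ := by rw [Real.mul_rpow (by norm_num) (by positivity)]; ring
  obtain ⟨x, y, hy, hxy, hlog⟩ := exists_pell_le_of_card hD hN₀lt
    (le_refl (2 * ∑ t ∈ Finset.range N₀, (((t : ℤ) ^ 2 - D).natAbs.divisors).card))
  refine ⟨x, y, hy, hxy, hlog.trans ?_⟩
  have hsum : ((2 * ∑ t ∈ Finset.range N₀, (((t : ℤ) ^ 2 - D).natAbs.divisors).card : ℕ) : ℝ) ≤
      6 * (K * 16 ^ (δ / 2)) * (s * (D : ℝ) ^ (δ / 2)) := by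
    push_cast
    calc _ ≤ 2 * (N₀ * (K * 16 ^ (δ / 2) * (D : ℝ) ^ (δ / 2))) := by
          gcongr
          have := Finset.sum_le_card_nsmul _ _ _ hterm
          simpa using this
      _ ≤ 2 * (3 * s * (K * 16 ^ (δ / 2) * (D : ℝ) ^ (δ / 2))) := by gcongr
      _ = _ := by ring
  have hDd : 1 ≤ (D : ℝ) ^ (δ / 2) := Real.one_le_rpow (by linarith) (by linarith)
  have h1 : (1 : ℝ) ≤ s * (D : ℝ) ^ (δ / 2) := one_le_mul_of_one_le_of_one_le hs1 hDd
  have hl : Real.log (3 * D) ≤ 3 ^ (δ / 2) / (δ / 2) * (D : ℝ) ^ (δ / 2) := by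
    refine (Real.log_le_rpow_div (by positivity) (half_pos hδ)).trans (le_of_eq ?_)
    rw [Real.mul_rpow (by norm_num) (by positivity)]; ring
  have hl0 : 0 ≤ Real.log (3 * D) := Real.log_nonneg (by linarith)
  have hprod : s * (D : ℝ) ^ (δ / 2) * (D : ℝ) ^ (δ / 2) = (D : ℝ) ^ (1 / 2 + δ) := by
    rw [hs, Real.sqrt_eq_rpow, ← Real.rpow_add (by linarith), ← Real.rpow_add (by linarith)]
    congr 1; ring
  have hP : 0 ≤ (D : ℝ) ^ (1 / 2 + δ) := by positivity
  calc _ ≤ 2 * (6 * (K * 16 ^ (δ / 2)) * (s * (D : ℝ) ^ (δ / 2)) + s * (D : ℝ) ^ (δ / 2)) *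
        (3 ^ (δ / 2) / (δ / 2) * (D : ℝ) ^ (δ / 2)) := by gcongr
    _ = 2 * (6 * (K * 16 ^ (δ / 2)) + 1) * (3 ^ (δ / 2) / (δ / 2)) *
        (s * (D : ℝ) ^ (δ / 2) * (D : ℝ) ^ (δ / 2)) := by ring
    _ ≤ _ := by rw [hprod]; linarith

theorem exists_numberField_sqrt (D D' : ℕ) : ∃ (F : Type) (_ : Field F) (_ : NumberField F)
    (ψ : F →+* ℝ) (r r' : F), Module.finrank ℚ F ≤ 4 ∧ ψ r = Real.sqrt D ∧ ψ r' = Real.sqrt D' := by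
  have key : ∀ D : ℕ, IsIntegral ℚ (Real.sqrt D) ∧
      Module.finrank ℚ (IntermediateField.adjoin ℚ {Real.sqrt D}) ≤ 2 := by
    intro D
    have hm : (Polynomial.X ^ 2 - Polynomial.C (D : ℚ)).Monic :=
      Polynomial.monic_X_pow_sub_C _ two_ne_zero
    have h0 : Polynomial.aeval (Real.sqrt D) (Polynomial.X ^ 2 - Polynomial.C (D : ℚ)) = 0 := by
      simp
    have hi : IsIntegral ℚ (Real.sqrt D) := ⟨_, hm, by simp⟩
    refine ⟨hi, ?_⟩
    rw [IntermediateField.adjoin.finrank hi]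
    refine (Polynomial.natDegree_le_of_dvd (minpoly.dvd ℚ _ h0) hm.ne_zero).trans ?_
    rw [Polynomial.natDegree_X_pow_sub_C]
  let E := IntermediateField.adjoin ℚ {Real.sqrt D}
  let E' := IntermediateField.adjoin ℚ {Real.sqrt D'}
  have fE : FiniteDimensional ℚ E := IntermediateField.adjoin.finiteDimensional (key D).1
  have fE' : FiniteDimensional ℚ E' := IntermediateField.adjoin.finiteDimensional (key D').1
  have fS : FiniteDimensional ℚ (E ⊔ E' : IntermediateField ℚ ℝ) :=
    IntermediateField.finiteDimensional_sup E E'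
  refine ⟨(E ⊔ E' : IntermediateField ℚ ℝ), inferInstance,
    { to_charZero := inferInstance, to_finiteDimensional := fS }, (E ⊔ E').val.toRingHom,
    ⟨Real.sqrt D, ?_⟩, ⟨Real.sqrt D', ?_⟩, ?_, rfl, rfl⟩
  · exact (le_sup_left : E ≤ E ⊔ E') (IntermediateField.mem_adjoin_simple_self ℚ _)
  · exact (le_sup_right : E' ≤ E ⊔ E') (IntermediateField.mem_adjoin_simple_self ℚ _)
  · calc _ ≤ Module.finrank ℚ E * Module.finrank ℚ E' := IntermediateField.finrank_sup_le E E'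
      _ ≤ 2 * 2 := Nat.mul_le_mul (key D).2 (key D').2

theorem quadratic_element_bounds {F : Type} [Field F] [NumberField F] (ψ : F →+* ℝ) {r : F}
    {D x y u v : ℕ} (hr : ψ r = Real.sqrt D) (hy : 0 < y) (hD : 0 < D)
    (hxy : x ^ 2 = D * y ^ 2 + 1) (hv : 0 < v) {a₀ : ℝ}
    (huv : |(u : ℝ) ^ 2 - D * v ^ 2| ≤ Real.exp a₀) (hDa : Real.sqrt D ≤ Real.exp a₀) :
    IsIntegral ℤ (x + y * r) ∧ IsIntegral ℤ (x + y * r)⁻¹ ∧ IsIntegral ℤ (u + v * r) ∧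
    IsIntegral ℤ r ∧
    ψ (x + y * r) = Real.exp (Real.log (x + y * Real.sqrt D)) ∧
    ψ (u + v * r) = Real.exp (Real.log (u + v * Real.sqrt D)) ∧
    1 / 2 ≤ Real.log (x + y * Real.sqrt D) ∧
    (∀ φ : F →+* ℂ, (‖φ (u + v * r)‖ = Real.exp (Real.log (u + v * Real.sqrt D)) ∧
        ‖φ (x + y * r)‖ = Real.exp (Real.log (x + y * Real.sqrt D))) ∨
      (‖φ (u + v * r)‖ ≤ Real.exp (a₀ - Real.log (u + v * Real.sqrt D)) ∧
        ‖φ (x + y * r)‖ = Real.exp (-Real.log (x + y * Real.sqrt D)))) ∧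
    (∀ φ : F →+* ℂ, ‖φ r‖ ≤ Real.exp a₀) := by
  set s := Real.sqrt D with hs
  have hD1 : (1 : ℝ) ≤ D := by exact_mod_cast hD
  have hs2 : s ^ 2 = D := Real.sq_sqrt (by positivity)
  have hs1 : 1 ≤ s := by rw [hs, Real.one_le_sqrt]; exact hD1
  have hr2 : r ^ 2 = D := ψ.injective (by rw [map_pow, hr, hs2, map_natCast])
  have hxyF : (x : F) ^ 2 = D * y ^ 2 + 1 := by exact_mod_cast congrArg (Nat.cast : ℕ → F) hxy
  have hxyR : (x : ℝ) ^ 2 = D * y ^ 2 + 1 := by exact_mod_cast congrArg (Nat.cast : ℕ → ℝ) hxy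
  have hy1 : (1 : ℝ) ≤ y := by exact_mod_cast hy
  have hv1 : (1 : ℝ) ≤ v := by exact_mod_cast hv
  have hx1 : (1 : ℝ) ≤ x := by
    have : x ≠ 0 := by rintro rfl; simp at hxy
    exact_mod_cast Nat.one_le_iff_ne_zero.mpr this
  have hys : 1 ≤ y * s := one_le_mul_of_one_le_of_one_le hy1 hs1
  have hvs : 1 ≤ v * s := one_le_mul_of_one_le_of_one_le hv1 hs1
  have hu0 : (0 : ℝ) ≤ u := Nat.cast_nonneg u
  have hEpos : 0 < x + y * s := by linarith
  have hApos : 0 < u + v * s := by linarith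
  have ir : IsIntegral ℤ r := by
    refine IsIntegral.of_pow two_pos ?_
    rw [hr2]
    exact_mod_cast isIntegral_algebraMap (R := ℤ) (A := F) (x := (D : ℤ))
  have inat : ∀ n : ℕ, IsIntegral ℤ (n : F) := fun n => by
    exact_mod_cast isIntegral_algebraMap (R := ℤ) (A := F) (x := (n : ℤ))
  have hprod : (x + y * r) * (x - y * r) = 1 := by linear_combination hxyF - (y : F) ^ 2 * hr2
  have hprodR : (x + y * s) * (x - y * s) = 1 := by linear_combination hxyR - (y : ℝ) ^ 2 * hs2
  have hinv : (x + y * r)⁻¹ = x - y * r := inv_eq_of_mul_eq_one_right hprod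
  have hlogE := Real.exp_log hEpos
  have hlogA := Real.exp_log hApos
  have hφr : ∀ φ : F →+* ℂ, φ r = s ∨ φ r = -s := by
    intro φ
    have h1 : (φ r) ^ 2 = (s : ℂ) ^ 2 := by
      rw [← map_pow, hr2, map_natCast]
      exact_mod_cast (congrArg Complex.ofReal hs2).symm
    exact sq_eq_sq_iff_eq_or_eq_neg.mp h1
  refine ⟨(inat x).add ((inat y).mul ir), ?_, (inat u).add ((inat v).mul ir), ir, ?_, ?_, ?_, ?_, ?_⟩
  · rw [hinv]; exact (inat x).sub ((inat y).mul ir)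
  · rw [hlogE]; simp [hr]
  · rw [hlogA]; simp [hr]
  · rw [Real.le_log_iff_exp_le hEpos]
    have : Real.exp (1 / 2) ≤ 2 := by
      have h1 : Real.exp (1 / 2) ^ 2 = Real.exp 1 := by
        rw [← Real.exp_nat_mul]; norm_num
      have h2 := Real.exp_one_lt_d9
      nlinarith [Real.exp_pos (1 / 2)]
    linarith
  · intro φ
    rcases hφr φ with h | h
    · left
      rw [hlogE, hlogA]
      constructor
      · rw [show φ (u + v * r) = ((u + v * s : ℝ) : ℂ) by simp [h], Complex.norm_real,
          Real.norm_of_nonneg hApos.le]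
      · rw [show φ (x + y * r) = ((x + y * s : ℝ) : ℂ) by simp [h], Complex.norm_real,
          Real.norm_of_nonneg hEpos.le]
    · right
      rw [Real.exp_sub, Real.exp_neg, hlogE, hlogA]
      constructor
      · rw [show φ (u + v * r) = ((u - v * s : ℝ) : ℂ) by simp [h]; ring, Complex.norm_real,
          Real.norm_eq_abs, le_div_iff₀ hApos]
        refine le_trans (le_of_eq ?_) huv
        rw [← abs_of_pos hApos, ← abs_mul]
        congr 1
        linear_combination (-(v : ℝ) ^ 2) * hs2
      · rw [show φ (x + y * r) = ((x - y * s : ℝ) : ℂ) by simp [h]; ring, Complex.norm_real,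
          eq_inv_of_mul_eq_one_right hprodR, Real.norm_of_nonneg (inv_nonneg.mpr hEpos.le)]
  · intro φ
    have : ‖φ r‖ = s := by
      rcases hφr φ with h | h <;> simp [h, abs_of_nonneg (zero_le_one.trans hs1)]
    rw [this]; exact hDa

theorem exists_pow_eq_add_mul_sqrt {D x y : ℕ} (hx : 0 < x) (hy : 0 < y)
    (hxy : x ^ 2 = D * y ^ 2 + 1) (i : ℕ) :
    ∃ X Z : ℕ, 0 < X ∧ (0 < i → 0 < Z) ∧ X ^ 2 = D * Z ^ 2 + 1 ∧
      ((x : ℝ) + y * Real.sqrt D) ^ i = X + Z * Real.sqrt D := by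
  have hs2 : Real.sqrt D ^ 2 = D := Real.sq_sqrt (by positivity)
  induction i with
  | zero => exact ⟨1, 0, one_pos, fun h => absurd h (lt_irrefl 0), by simp, by simp⟩
  | succ i ih =>
    obtain ⟨X, Z, hX, -, h, he⟩ := ih
    refine ⟨X * x + D * (Z * y), X * y + Z * x, by positivity, fun _ => by positivity, ?_, ?_⟩
    · zify at h hxy ⊢
      linear_combination (x ^ 2 - D * y ^ 2 : ℤ) * h + hxy
    · rw [pow_succ, he]
      push_cast
      linear_combination ((Z : ℝ) * y) * hs2

theorem pell_pow_ne_pow {D D' x y x' y' : ℕ} (hD : 0 < D) (hDD : ¬ IsSquare (D * D'))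
    (hx : 0 < x) (hy : 0 < y) (hxy : x ^ 2 = D * y ^ 2 + 1)
    (hx' : 0 < x') (hy' : 0 < y') (hxy' : x' ^ 2 = D' * y' ^ 2 + 1) (i j : ℕ) (hi : 0 < i) :
    ((x : ℝ) + y * Real.sqrt D) ^ i ≠ (x' + y' * Real.sqrt D') ^ j := by
  intro heq
  obtain ⟨X, Z, hX, hZ, h, he⟩ := exists_pow_eq_add_mul_sqrt hx hy hxy i
  obtain ⟨X', Z', hX', -, h', he'⟩ := exists_pow_eq_add_mul_sqrt hx' hy' hxy' j
  have hZ := hZ hi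
  rw [he, he'] at heq
  have hs2 : Real.sqrt D ^ 2 = D := Real.sq_sqrt (by positivity)
  have hs2' : Real.sqrt D' ^ 2 = D' := Real.sq_sqrt (by positivity)
  have hR : (X : ℝ) ^ 2 = D * Z ^ 2 + 1 := by exact_mod_cast h
  have hR' : (X' : ℝ) ^ 2 = D' * Z' ^ 2 + 1 := by exact_mod_cast h'
  have hpos : (0 : ℝ) < X + Z * Real.sqrt D := by positivity
  have hc : (X : ℝ) - Z * Real.sqrt D = X' - Z' * Real.sqrt D' := by
    apply mul_left_cancel₀ hpos.ne'
    calc _ = (1 : ℝ) := by linear_combination hR - (Z : ℝ) ^ 2 * hs2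
      _ = (X' + Z' * Real.sqrt D') * (X' - Z' * Real.sqrt D') := by
        linear_combination (Z' : ℝ) ^ 2 * hs2' - hR'
      _ = _ := by rw [heq]
  have hZZ : (Z : ℝ) * Real.sqrt D = Z' * Real.sqrt D' := by linarith
  have h1 : (Z : ℝ) ^ 2 * D = Z' ^ 2 * D' := by
    rw [← hs2, ← hs2', ← mul_pow, ← mul_pow, hZZ]
  have h2 : Z ^ 2 * D = Z' ^ 2 * D' := by exact_mod_cast h1
  have h3 : (Z * D) ^ 2 = Z' ^ 2 * (D * D') := by
    calc (Z * D) ^ 2 = (Z ^ 2 * D) * D := by ring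
      _ = _ := by rw [h2]; ring
  obtain ⟨w, hw⟩ := (Nat.pow_dvd_pow_iff two_ne_zero).mp (Dvd.intro _ h3.symm : Z' ^ 2 ∣ (Z * D) ^ 2)
  rw [hw, mul_pow] at h3
  have hZ' : Z' ≠ 0 := by
    rintro rfl
    have : Z * D = 0 := by rw [hw, zero_mul]
    exact (Nat.mul_pos hZ hD).ne' this
  exact hDD ⟨w, by rw [← pow_two]; exact (Nat.eq_of_mul_eq_mul_left (by positivity) h3).symm⟩

theorem abs_log_sub_log_le {a b : ℝ} (ha : 1 ≤ a) (hb : 1 ≤ b) :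
    |Real.log a - Real.log b| ≤ |a - b| := by
  have gen : ∀ a b : ℝ, 1 ≤ a → 1 ≤ b → Real.log a - Real.log b ≤ |a - b| := by
    intro a b ha hb
    rw [← Real.log_div (by linarith) (by linarith)]
    have h := Real.log_le_sub_one_of_pos (show 0 < a / b by positivity)
    refine h.trans ?_
    have : a / b - 1 = (a - b) / b := by field_simp
    rw [this]
    refine (le_abs_self _).trans ?_
    rw [abs_div, abs_of_pos (show 0 < b by linarith)]
    exact div_le_self (abs_nonneg _) hb
  have g1 := gen _ _ ha hb
  have g2 := gen _ _ hb ha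
  rw [abs_sub_comm b a] at g2
  rw [abs_le]
  constructor <;> linarith

theorem abs_log_sub_log_sub_log_le {u v t b a₀ : ℝ} (ht : 1 ≤ t) (hv : 1 ≤ v) (hu : 0 ≤ u)
    (hA : Real.exp b ≤ u + v * t) (hK : |u ^ 2 - t ^ 2 * v ^ 2| ≤ Real.exp a₀) :
    |Real.log (u + v * t) - Real.log t - Real.log (2 * v)| ≤ Real.exp (a₀ - b) := by
  have ht0 : 0 < t := by linarith
  have hA0 : 0 < u + v * t := by positivity
  have hB : 1 ≤ (u + v * t) / t := by
    rw [le_div_iff₀ ht0]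
    linarith [le_mul_of_one_le_left ht0.le hv]
  rw [← Real.log_div hA0.ne' ht0.ne']
  refine (abs_log_sub_log_le hB (by linarith)).trans ?_
  have e : (u + v * t) / t - 2 * v = (u ^ 2 - t ^ 2 * v ^ 2) / (t * (u + v * t)) := by
    have := hA0.ne'
    field_simp
    ring
  rw [e, abs_div, Real.exp_sub]
  have hden : Real.exp b ≤ |t * (u + v * t)| := by
    rw [abs_of_pos (by positivity)]
    exact hA.trans (le_mul_of_one_le_left hA0.le ht)
  gcongr

set_option maxHeartbeats 1000000 in
/-- Three large integers cannot have squares nearly proportional to three small integers lying in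
distinct square classes. -/
theorem eventually_no_simultaneous_pell {κ C₁ ε : ℝ} (hκ : 0 < κ) (hε : 0 < ε)
    (hκε : κ ≤ 1 / 2 - ε) :
    ∀ᶠ Y : ℝ in atTop, ∀ s₁ s₂ s₃ d₁ d₂ d₃ : ℕ, 0 < s₁ → 0 < s₂ → 0 < s₃ →
      (s₁ : ℝ) ≤ 6 * Y ^ (κ / 2) → (s₂ : ℝ) ≤ 6 * Y ^ (κ / 2) → (s₃ : ℝ) ≤ 6 * Y ^ (κ / 2) →
      ¬ IsSquare (s₁ * s₂) → ¬ IsSquare (s₁ * s₃) → ¬ IsSquare (s₂ * s₃) →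
      Real.exp (Y / 5) ≤ d₁ → (d₁ : ℝ) ≤ Real.exp Y → Real.exp (Y / 5) ≤ d₂ →
      (d₂ : ℝ) ≤ Real.exp Y → Real.exp (Y / 5) ≤ d₃ → (d₃ : ℝ) ≤ Real.exp Y →
      |(s₁ : ℝ) * d₂ ^ 2 - s₂ * d₁ ^ 2| ≤ Real.exp (C₁ * Y ^ κ) →
      |(s₁ : ℝ) * d₃ ^ 2 - s₃ * d₁ ^ 2| ≤ Real.exp (C₁ * Y ^ κ) → False := by
  set δ := ε / 10 with hδ
  have hδ0 : 0 < δ := by positivity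
  have hεκ : ε < 1 / 2 := by linarith
  obtain ⟨C, hC1, hC⟩ := exists_pell_log_le δ hδ0
  have q := eventually_unit_relation_false (C := 2) (c := 1 / 6) (δ := δ) (μ := κ / 2 + 2 * δ)
    (κ := κ + δ) (by norm_num) (by norm_num) hδ0 (by linarith) (by positivity) (by linarith)
    (by linarith)
  have e1 := eventually_const_mul_rpow_le (C * 36 ^ (1 / 2 + δ))
    (show κ * (1 / 2 + δ) < κ / 2 + 2 * δ by
      linarith [mul_lt_mul_of_pos_right (show κ < 2 by linarith) hδ0])
  have e2 := eventually_const_mul_rpow_le (2 * C₁) (show κ < κ + δ by linarith)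
  have e3 := eventually_const_mul_log_le_rpow 4 (show 0 < κ + δ by linarith)
  have e4 := eventually_const_mul_rpow_le 60 (show κ + δ < 1 by linarith)
  have e5 := eventually_const_mul_le_exp 12 one_pos
  filter_upwards [q, e1, e2, e3, e4, e5, eventually_ge_atTop 60] with Y hq h1 h2 h3 h4 h5 hY
  intro s₁ s₂ s₃ d₁ d₂ d₃ p₁ p₂ p₃ b₁ b₂ b₃ n₁₂ n₁₃ n₂₃ l₁ u₁ l₂ u₂ l₃ u₃ k₂ k₃
  rw [Real.rpow_one] at h4
  rw [one_mul] at h5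
  have hY0 : 0 < Y := by linarith
  have hY1 : 1 ≤ Y := by linarith
  have hYκ : Y ^ (κ / 2) ≤ Y := Real.rpow_le_self_of_one_le hY1 (by linarith)
  set a₀ := Y ^ (κ + δ) with ha₀
  have ha₀0 : 0 ≤ a₀ := by positivity
  have hlogY : Real.log (6 * Y) ≤ 2 * Real.log Y := by
    rw [Real.log_mul (by norm_num) hY0.ne', two_mul]
    gcongr; linarith
  have h6Y : 6 * Y ≤ Real.exp (a₀ / 2) := by
    rw [← Real.log_le_iff_le_exp (by positivity)]; linarith
  have hea : Real.exp (a₀ / 2) ≤ Real.exp a₀ := Real.exp_le_exp.mpr (by linarith)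
  have hkb : 6 * Y * Real.exp (C₁ * Y ^ κ) ≤ Real.exp a₀ := by
    calc _ ≤ Real.exp (a₀ / 2) * Real.exp (a₀ / 2) := by
          gcongr; linarith
      _ = _ := by rw [← Real.exp_add]; ring_nf
  have h12Y : 12 * Y * Real.exp Y ≤ Real.exp (2 * Y) := by
    rw [two_mul, Real.exp_add]; gcongr
  have c₁ : (s₁ : ℝ) ≤ 6 * Y := b₁.trans (by linarith)
  have r₁ : (1 : ℝ) ≤ s₁ := by exact_mod_cast p₁
  have hd₁ : 0 < d₁ := by exact_mod_cast (Real.exp_pos _).trans_le l₁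
  have key : ∀ s d : ℕ, 0 < s → (s : ℝ) ≤ 6 * Y ^ (κ / 2) → ¬ IsSquare (s₁ * s) →
      Real.exp (Y / 5) ≤ d → (d : ℝ) ≤ Real.exp Y →
      |(s₁ : ℝ) * d ^ 2 - s * d₁ ^ 2| ≤ Real.exp (C₁ * Y ^ κ) →
      (∃ x y : ℕ, 0 < x ∧ 0 < y ∧ x ^ 2 = (s₁ * s) * y ^ 2 + 1 ∧
        Real.log (x + y * Real.sqrt (s₁ * s : ℕ)) ≤ Y ^ (κ / 2 + 2 * δ)) ∧
      0 < s₁ * s ∧ |((s₁ * d : ℕ) : ℝ) ^ 2 - (s₁ * s : ℕ) * d₁ ^ 2| ≤ Real.exp a₀ ∧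
      Real.sqrt (s₁ * s : ℕ) ≤ Real.exp a₀ ∧ 0 < Real.sqrt (s₁ * s : ℕ) ∧
      |Real.log (Real.sqrt (s₁ * s : ℕ))| ≤ a₀ ∧
      1 / 6 * Y ≤ Real.log ((s₁ * d : ℕ) + d₁ * Real.sqrt (s₁ * s : ℕ)) ∧
      Real.log ((s₁ * d : ℕ) + d₁ * Real.sqrt (s₁ * s : ℕ)) ≤ 2 * Y ∧
      |Real.log ((s₁ * d : ℕ) + d₁ * Real.sqrt (s₁ * s : ℕ)) - Real.log (Real.sqrt (s₁ * s : ℕ)) -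
        Real.log (2 * d₁)| ≤ Real.exp (a₀ - Y / 5) := by
    intro s d ps bs ns ld ud ks
    have c : (s : ℝ) ≤ 6 * Y := bs.trans (by linarith)
    have r : (1 : ℝ) ≤ s := by exact_mod_cast ps
    have hpD : 0 < s₁ * s := Nat.mul_pos p₁ ps
    set D := s₁ * s with hD
    have hDR : (D : ℝ) = s₁ * s := by rw [hD]; push_cast; ring
    have hD1 : (1 : ℝ) ≤ D := by exact_mod_cast hpD
    set t := Real.sqrt D with ht
    have ht2 : t ^ 2 = D := Real.sq_sqrt (by positivity)
    have ht1 : 1 ≤ t := by rw [ht, Real.one_le_sqrt]; exact hD1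
    have htY : t ≤ 6 * Y := by
      rw [ht]; apply Real.sqrt_le_iff.mpr ⟨by positivity, ?_⟩
      rw [hDR, pow_two]; gcongr
    have hdpos : (0 : ℝ) < d := (Real.exp_pos _).trans_le ld
    have hd1pos : (0 : ℝ) < d₁ := by exact_mod_cast hd₁
    have hd1one : (1 : ℝ) ≤ d₁ := by exact_mod_cast hd₁
    have hA1 : (d : ℝ) ≤ (s₁ * d : ℕ) := by
      push_cast; exact le_mul_of_one_le_left hdpos.le r₁
    have hdt : 0 < d₁ * t := by positivity
    have hA : Real.exp (Y / 5) ≤ (s₁ * d : ℕ) + d₁ * t := by linarith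
    have hA0 : 0 < (s₁ * d : ℕ) + d₁ * t := (Real.exp_pos _).trans_le hA
    have hK : |((s₁ * d : ℕ) : ℝ) ^ 2 - D * d₁ ^ 2| ≤ Real.exp a₀ := by
      calc |((s₁ * d : ℕ) : ℝ) ^ 2 - D * d₁ ^ 2| = |(s₁ : ℝ) * (s₁ * d ^ 2 - s * d₁ ^ 2)| := by
            rw [hDR]; push_cast; congr 1; ring
        _ = s₁ * |(s₁ : ℝ) * d ^ 2 - s * d₁ ^ 2| := by rw [abs_mul, abs_of_pos (by linarith)]
        _ ≤ 6 * Y * Real.exp (C₁ * Y ^ κ) := by gcongr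
        _ ≤ _ := hkb
    refine ⟨?_, hpD, hK, by linarith, by linarith, ?_, ?_, ?_, ?_⟩
    · obtain ⟨x, y, hy, hxy, hl⟩ := hC D ns
      refine ⟨x, y, ?_, hy, hxy, hl.trans (le_trans ?_ h1)⟩
      · apply Nat.pos_of_ne_zero; rintro rfl; simp at hxy
      · have hD36 : (D : ℝ) ≤ 36 * Y ^ κ := by
          calc (D : ℝ) = s₁ * s := hDR
            _ ≤ (6 * Y ^ (κ / 2)) * (6 * Y ^ (κ / 2)) := by gcongr
            _ = 36 * (Y ^ (κ / 2) * Y ^ (κ / 2)) := by ring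
            _ = _ := by rw [← Real.rpow_add hY0, add_halves]
        calc C * (D : ℝ) ^ (1 / 2 + δ) ≤ C * (36 * Y ^ κ) ^ (1 / 2 + δ) := by gcongr
          _ = _ := by
            rw [Real.mul_rpow (by norm_num) (by positivity), ← Real.rpow_mul hY0.le]; ring
    · rw [abs_of_nonneg (Real.log_nonneg ht1), Real.log_le_iff_le_exp (by linarith)]
      linarith
    · rw [Real.le_log_iff_exp_le hA0]
      refine le_trans (Real.exp_le_exp.mpr ?_) hA
      linarith
    · rw [Real.log_le_iff_le_exp hA0]
      refine le_trans ?_ h12Y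
      push_cast
      calc (s₁ : ℝ) * d + d₁ * t ≤ 6 * Y * Real.exp Y + Real.exp Y * (6 * Y) := by gcongr
        _ = _ := by ring
    · exact abs_log_sub_log_sub_log_le ht1 hd1one (Nat.cast_nonneg _) hA (by rw [ht2]; exact hK)
  obtain ⟨⟨x, y, hx, hy, hxy, hl⟩, hD, hK, hsa, hs0, hsl, hal, hau, hη⟩ :=
    key s₂ d₂ p₂ b₂ n₁₂ l₂ u₂ k₂
  obtain ⟨⟨x', y', hx', hy', hxy', hl'⟩, hD', hK', hsa', hs0', hsl', hal', hau', hη'⟩ :=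
    key s₃ d₃ p₃ b₃ n₁₃ l₃ u₃ k₃
  have hDD : ¬ IsSquare (s₁ * s₂ * (s₁ * s₃)) := by
    rintro ⟨w, hw⟩
    have h1 : w ^ 2 = s₁ ^ 2 * (s₂ * s₃) := by rw [pow_two, ← hw]; ring
    obtain ⟨v, rfl⟩ := (Nat.pow_dvd_pow_iff two_ne_zero).mp (Dvd.intro _ h1.symm : s₁ ^ 2 ∣ w ^ 2)
    rw [mul_pow] at h1
    exact n₂₃ ⟨v, by rw [← pow_two]; exact (Nat.eq_of_mul_eq_mul_left (by positivity) h1).symm⟩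
  have hne := pell_pow_ne_pow hD hDD hx hy hxy hx' hy' hxy'
  obtain ⟨F, iF, nF, ψ, r, r', hfin, hr, hr'⟩ := exists_numberField_sqrt (s₁ * s₂) (s₁ * s₃)
  obtain ⟨f1, f2, f3, f4, f5, f6, f7, f8, f9⟩ :=
    quadratic_element_bounds ψ hr hy hD hxy hd₁ hK hsa
  obtain ⟨g1, g2, g3, g4, g5, g6, g7, g8, g9⟩ :=
    quadratic_element_bounds ψ hr' hy' hD' hxy' hd₁ hK' hsa'
  refine hq F ψ _ _ _ _ r r' _ _ _ _ a₀ hfin f1 f2 g1 g2 f3 g3 f4 g4 f5 g5 f6 g6 f7 hl g7 hl'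
    hal hau hal' hau' ha₀0 le_rfl f8 g8 f9 g9 (by rw [hr]; exact hs0) (by rw [hr']; exact hs0')
    (by rw [hr]; exact hsl) (by rw [hr']; exact hsl') ?_ ?_
  · intro i j hi
    have := hne i j hi
    simpa [hr, hr'] using this
  · rw [hr, hr']
    have h2e : 2 * Real.exp (a₀ - Y / 5) ≤ Real.exp (-(1 / 6 * Y)) := by
      have : (2 : ℝ) ≤ Real.exp 1 := by linarith [Real.exp_one_gt_d9]
      calc 2 * Real.exp (a₀ - Y / 5) ≤ Real.exp 1 * Real.exp (a₀ - Y / 5) := by gcongr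
        _ = Real.exp (1 + (a₀ - Y / 5)) := (Real.exp_add _ _).symm
        _ ≤ _ := Real.exp_le_exp.mpr (by linarith)
    refine le_trans ?_ h2e
    rw [abs_le] at hη hη' ⊢
    constructor <;> linarith [hη.1, hη.2, hη'.1, hη'.2]

/-- If every element of `P` has at most one other element in its square class, then five elements
contain three with pairwise non-square products. -/
theorem exists_triple_not_isSquare_mul {P : Finset ℕ} {q : ℤ} (hP : 5 ≤ P.card)
    (h0 : ∀ a ∈ P, 0 < a)
    (hq : ∀ a ∈ P, ∀ b ∈ P, a ≠ b → IsSquare (a * b) → (a : ℤ) * b = q) :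
    ∃ a ∈ P, ∃ b ∈ P, ∃ c ∈ P, ¬ IsSquare (a * b) ∧ ¬ IsSquare (a * c) ∧ ¬ IsSquare (b * c) := by
  classical
  have hdeg : ∀ a ∈ P, ∀ Q ⊆ P, Q.card ≤ (Q.filter fun b => ¬ IsSquare (a * b)).card + 2 := by
    intro a ha Q hQ
    have h1 : ((Q.filter fun b => IsSquare (a * b)).erase a).card ≤ 1 := by
      rw [Finset.card_le_one]
      intro b hb c hc
      simp only [Finset.mem_erase, Finset.mem_filter] at hb hc
      have hb' := hq a ha b (hQ hb.2.1) (Ne.symm hb.1) hb.2.2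
      have hc' := hq a ha c (hQ hc.2.1) (Ne.symm hc.1) hc.2.2
      have ha0 : (a : ℤ) ≠ 0 := by exact_mod_cast (h0 a ha).ne'
      exact_mod_cast mul_left_cancel₀ ha0 (hb'.trans hc'.symm)
    have h2 := Finset.pred_card_le_card_erase (s := Q.filter fun b => IsSquare (a * b)) (a := a)
    have h3 := Finset.card_filter_add_card_filter_not (s := Q) (fun b => IsSquare (a * b))
    omega
  obtain ⟨a, ha⟩ := Finset.card_pos.mp (show 0 < P.card by omega)
  have h1 := hdeg a ha P subset_rfl
  set Q := P.filter fun b => ¬ IsSquare (a * b) with hQ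
  have hQP : Q ⊆ P := Finset.filter_subset _ _
  obtain ⟨b, hb⟩ := Finset.card_pos.mp (show 0 < Q.card by omega)
  have h2 := hdeg b (hQP hb) Q hQP
  obtain ⟨c, hc⟩ := Finset.card_pos.mp
    (show 0 < (Q.filter fun c => ¬ IsSquare (b * c)).card by omega)
  obtain ⟨hcQ, hbc⟩ := Finset.mem_filter.mp hc
  exact ⟨a, ha, b, hQP hb, c, hQP hcQ, (Finset.mem_filter.mp hb).2, (Finset.mem_filter.mp hcQ).2, hbc⟩

theorem divisor_pair_bounds {N R : ℕ} {m n : ℤ} {q w V : ℝ} (hw : 0 < w) (hwq : w ^ 2 = q)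
    (hqN : q ^ 2 = N) (hV : 1 ≤ V) (hwV : 10 * V ≤ w) (hqR : |q - R| ≤ 1 / 4)
    (hmn : m * n = N) (hn : |(n : ℝ) - q| ≤ 2 * w * V) :
    0 < m ∧ 0 < n ∧ 0 ≤ m + n - 2 * R ∧ ((m + n - 2 * R : ℤ) : ℝ) ≤ 6 * V ^ 2 := by
  have hq0 : 0 < q := by rw [← hwq]; positivity
  have hW : 2 * w * V ≤ q / 5 := by
    rw [← hwq]; linarith [mul_le_mul_of_nonneg_left hwV hw.le]
  have hmnR : (m : ℝ) * n = q ^ 2 := by rw [hqN]; exact_mod_cast hmn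
  have hn1 : 4 * q / 5 ≤ n := by linarith [(abs_le.mp hn).1]
  have hn0 : (0 : ℝ) < n := by linarith
  have hm0 : (0 : ℝ) < m := by
    by_contra h
    have := mul_nonpos_of_nonpos_of_nonneg (not_lt.mp h) hn0.le
    have : 0 < q ^ 2 := by positivity
    linarith
  have hsq : ((m : ℝ) + n - 2 * q) * n = (n - q) ^ 2 := by linear_combination hmnR
  have h0 : 0 ≤ (m : ℝ) + n - 2 * q := by
    by_contra h
    have := mul_neg_of_neg_of_pos (not_le.mp h) hn0
    linarith [sq_nonneg ((n : ℝ) - q)]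
  have h5 : (m : ℝ) + n - 2 * q ≤ 5 * V ^ 2 := by
    have h1 : ((n : ℝ) - q) ^ 2 ≤ (2 * w * V) ^ 2 := by
      rw [← sq_abs]; exact pow_le_pow_left₀ (abs_nonneg _) hn 2
    have h2 : (2 * w * V) ^ 2 = 4 * q * V ^ 2 := by rw [← hwq]; ring
    have h3 := mul_le_mul_of_nonneg_left hn1 h0
    have h4 : ((m : ℝ) + n - 2 * q) * (4 * q / 5) ≤ 5 * V ^ 2 * (4 * q / 5) := by linarith
    exact le_of_mul_le_mul_right h4 (by positivity)
  have hqR' := abs_le.mp hqR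
  have hV2 : 1 ≤ V ^ 2 := one_le_pow₀ hV
  refine ⟨by exact_mod_cast hm0, by exact_mod_cast hn0, ?_, ?_⟩
  · have : (-1 : ℝ) < ((m + n - 2 * R : ℤ) : ℝ) := by push_cast; linarith [hqR'.1, hqR'.2]
    have : (-1 : ℤ) < m + n - 2 * R := by exact_mod_cast this
    omega
  · push_cast; linarith [hqR'.1, hqR'.2]

theorem card_filter_add_eq_le_two (A : Finset (ℤ × ℤ)) {N c : ℤ} (h : ∀ x ∈ A, x.1 * x.2 = N)
    (hc : ∀ x ∈ A, x.1 + x.2 = c) : A.card ≤ 2 := by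
  classical
  rcases A.eq_empty_or_nonempty with rfl | ⟨x₀, hx₀⟩
  · simp
  refine (Finset.card_le_card (t := {x₀, x₀.swap}) ?_).trans Finset.card_le_two
  intro x hx
  have h1 := h x hx
  have h2 := hc x hx
  have h3 := h x₀ hx₀
  have h4 := hc x₀ hx₀
  have h5 : (x.1 - x₀.1) * (x.1 - x₀.2) = 0 := by
    linear_combination h3 - h1 + x.1 * (h2 - h4)
  rw [Finset.mem_insert, Finset.mem_singleton, Prod.ext_iff, Prod.ext_iff]
  rcases mul_eq_zero.mp h5 with h6 | h6
  · left; constructor <;> linarith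
  · right; constructor <;> simp only [Prod.fst_swap, Prod.snd_swap] <;> linarith

theorem mul_eq_of_isSquare_of_small {s s' d d' : ℕ} {r : ℤ} {B : ℝ} (hs : 0 < s)
    (hne : s ≠ s') (hsq : IsSquare (s * s'))
    (hid : (s : ℤ) * d' ^ 2 - s' * d ^ 2 = (s' - s) * (s * s' + 4 * r))
    (hsmall : s * |(s : ℝ) * d' ^ 2 - s' * d ^ 2| < B) (hd' : B ≤ d') :
    (s : ℤ) * s' = -4 * r := by
  by_contra h
  obtain ⟨w, hw⟩ := hsq
  have hK : (s : ℤ) * d' ^ 2 - s' * d ^ 2 ≠ 0 := by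
    rw [hid]
    refine mul_ne_zero (sub_ne_zero.mpr (by exact_mod_cast hne.symm)) ?_
    intro h0; apply h; linarith
  have hwZ : (s : ℤ) * s' = w * w := by exact_mod_cast hw
  have hfac : (s : ℤ) * (s * d' ^ 2 - s' * d ^ 2) = (s * d' - w * d) * (s * d' + w * d) := by
    linear_combination (-(d : ℤ) ^ 2) * hwZ
  have hne0 : (s : ℤ) * d' - w * d ≠ 0 := by
    intro h0
    rw [h0, zero_mul] at hfac
    rcases mul_eq_zero.mp hfac with h1 | h1
    · exact hs.ne' (by exact_mod_cast h1)
    · exact hK h1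
  have h1 : (d' : ℤ) ≤ s * |(s : ℤ) * d' ^ 2 - s' * d ^ 2| := by
    have hs1 : (1 : ℤ) ≤ s := by exact_mod_cast hs
    have hsum : (d' : ℤ) ≤ s * d' + w * d := by
      have := le_mul_of_one_le_left (Int.natCast_nonneg d') hs1
      have : (0 : ℤ) ≤ w * d := by positivity
      linarith
    calc (d' : ℤ) ≤ s * d' + w * d := hsum
      _ ≤ |(s : ℤ) * d' - w * d| * (s * d' + w * d) :=
        le_mul_of_one_le_left (by positivity) (Int.one_le_abs hne0)
      _ = |(s : ℤ) * (s * d' ^ 2 - s' * d ^ 2)| := by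
        rw [hfac, abs_mul, abs_of_nonneg (show (0 : ℤ) ≤ s * d' + w * d by positivity)]
      _ = _ := by rw [abs_mul, Nat.abs_cast]
  have h2 : (d' : ℝ) ≤ s * |(s : ℝ) * d' ^ 2 - s' * d ^ 2| := by exact_mod_cast h1
  linarith

theorem abs_exp_half_log_sub_le {N R : ℕ} {q E : ℝ} (hq : 0 < q) (hqN : q ^ 2 = N)
    (hE : 16 * E ≤ q) (hR : |(N : ℝ) - (R : ℝ) ^ 2| ≤ 4 * E) : |q - R| ≤ 1 / 4 := by
  have h1 : |q - R| * (q + R) ≤ 4 * E := by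
    calc |q - R| * (q + R) = |q - R| * |q + R| := by
          rw [abs_of_nonneg (show 0 ≤ q + R by positivity)]
      _ = |(N : ℝ) - (R : ℝ) ^ 2| := by rw [← abs_mul, ← hqN]; congr 1; ring
      _ ≤ _ := hR
  have h2 : |q - R| * q ≤ |q - R| * (q + R) := by
    gcongr
    linarith [Nat.cast_nonneg (α := ℝ) R]
  have h3 : |q - R| * q ≤ 1 / 4 * q := by linarith
  exact le_of_mul_le_mul_right h3 hq

theorem exists_difference_of_divisor_pair {N R : ℕ} {m n : ℤ} {q E Y b : ℝ} (hY : Real.exp Y = N)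
    (hm : 0 < m) (hn : 0 < n) (hmn : m * n = N) (hs : 0 < m + n - 2 * R)
    (hR : |(N : ℝ) - (R : ℝ) ^ 2| ≤ 4 * E) (hE : 16 * E ≤ q) (hqR : |q - R| ≤ 1 / 4)
    (hq1 : 1 ≤ q) (hb : Real.exp b ^ 2 ≤ q) :
    ∃ d : ℕ, (d : ℤ) ^ 2 = 4 * R * (m + n - 2 * R) + (m + n - 2 * R) ^ 2 - 4 * (N - R ^ 2) ∧
      Real.exp b ≤ d ∧ (d : ℝ) ≤ Real.exp Y := by
  have hd2 : (((n - m).natAbs : ℕ) : ℤ) ^ 2 =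
      4 * R * (m + n - 2 * R) + (m + n - 2 * R) ^ 2 - 4 * (N - R ^ 2) := by
    rw [Int.natCast_natAbs, sq_abs]; linear_combination (-4) * hmn
  refine ⟨(n - m).natAbs, hd2, ?_, ?_⟩
  · rw [← pow_le_pow_iff_left₀ (Real.exp_pos _).le (Nat.cast_nonneg _) two_ne_zero]
    generalize (n - m).natAbs = d at hd2 ⊢
    have h1 : (d : ℝ) ^ 2 = 4 * R * ((m + n - 2 * R : ℤ) : ℝ) +
        ((m + n - 2 * R : ℤ) : ℝ) ^ 2 - 4 * (N - R ^ 2) := by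
      have := congrArg (Int.cast : ℤ → ℝ) hd2
      push_cast at this ⊢
      exact this
    have h2 : (1 : ℝ) ≤ ((m + n - 2 * R : ℤ) : ℝ) := by exact_mod_cast hs
    have h3 : (R : ℝ) ≤ R * ((m + n - 2 * R : ℤ) : ℝ) :=
      le_mul_of_one_le_right (Nat.cast_nonneg _) h2
    rw [h1]
    linarith [(abs_le.mp hR).2, (abs_le.mp hqR).2, sq_nonneg ((m + n - 2 * R : ℤ) : ℝ)]
  · rw [hY]
    have h1 : m ≤ N := by rw [← hmn]; exact le_mul_of_one_le_right hm.le hn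
    have h2 : n ≤ N := by rw [← hmn]; exact le_mul_of_one_le_left hn.le hm
    have : (n - m).natAbs ≤ N := by omega
    exact_mod_cast this

theorem eventually_encard_divisor_pairs_le {κ ε : ℝ} (hκ : 0 < κ) (hε : 0 < ε)
    (hκε : κ ≤ 1 / 2 - ε) :
    ∀ᶠ Y : ℝ in atTop, ∀ N R : ℕ, 0 < N → Real.log N = Y →
      |(N : ℝ) - (R : ℝ) ^ 2| ≤ 4 * Real.exp (2 * Y ^ κ) →
      {x : ℤ × ℤ | x.1 * x.2 = (N : ℤ) ∧ |(x.2 : ℝ) - (N : ℝ) ^ ((1 : ℝ) / 2)| ≤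
        2 * (N : ℝ) ^ ((1 : ℝ) / 4) * Y ^ (κ / 4)}.encard ≤ 10 := by
  have q := eventually_no_simultaneous_pell (C₁ := 3) hκ hε hκε
  have e1 := eventually_const_mul_le_exp 10 (show (0 : ℝ) < 1 / 4 by norm_num)
  have e2 := eventually_const_mul_rpow_le 150 (show κ < 1 by linarith)
  have e3 := eventually_const_mul_log_le_rpow 4 hκ
  filter_upwards [q, e1, e2, e3, eventually_ge_atTop 102] with Y hq h1 h2 h3 hY
  intro N R hN hlog hR
  classical
  rw [Real.rpow_one] at h2
  have hY0 : 0 < Y := by linarith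
  have hY1 : 1 ≤ Y := by linarith
  have hNR : (0 : ℝ) < N := by exact_mod_cast hN
  have hexp : Real.exp Y = N := by rw [← hlog, Real.exp_log hNR]
  set E := Real.exp (Y ^ κ) with hE
  have hE2 : Real.exp (2 * Y ^ κ) = E ^ 2 := by rw [hE, ← Real.exp_nat_mul]; norm_num
  have hE3 : Real.exp (3 * Y ^ κ) = E ^ 3 := by rw [hE, ← Real.exp_nat_mul]; norm_num
  have hYE : Y ^ 4 ≤ E := by
    rw [hE, ← Real.log_le_iff_le_exp (by positivity), Real.log_pow]
    exact_mod_cast h3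
  have hE3le : E ^ 3 ≤ Real.exp (Y / 50) := by
    rw [← hE3]; exact Real.exp_le_exp.mpr (by linarith)
  have hE0 : 0 < E := Real.exp_pos _
  have hY3 : 102 * Y ≤ Y ^ 4 := by
    calc 102 * Y ≤ Y * Y := by gcongr
      _ = Y ^ 2 := by ring
      _ ≤ Y ^ 4 := pow_le_pow_right₀ hY1 (by norm_num)
  have h36 : 36 * Y ^ 2 ≤ Y ^ 4 := by
    calc 36 * Y ^ 2 ≤ Y * Y ^ 2 := by gcongr; linarith
      _ = Y ^ 3 := by ring
      _ ≤ Y ^ 4 := pow_le_pow_right₀ hY1 (by norm_num)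
  have hE102 : 102 ≤ E := by linarith
  have hE12 : E ≤ E ^ 2 := le_self_pow₀ (by linarith) two_ne_zero
  have h16 : 16 * E ^ 2 ≤ E ^ 3 := by
    calc 16 * E ^ 2 ≤ E * E ^ 2 := by gcongr; linarith
      _ = _ := by ring
  have hsq : (N : ℝ) ^ ((1 : ℝ) / 2) = Real.exp (Y / 2) := by
    rw [Real.rpow_def_of_pos hNR, hlog]; ring_nf
  have hfr : (N : ℝ) ^ ((1 : ℝ) / 4) = Real.exp (Y / 4) := by
    rw [Real.rpow_def_of_pos hNR, hlog]; ring_nf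
  rw [hsq, hfr]
  have hqN : Real.exp (Y / 2) ^ 2 = N := by
    rw [← hexp, ← Real.exp_nat_mul]; congr 1; push_cast; ring
  have hwq : Real.exp (Y / 4) ^ 2 = Real.exp (Y / 2) := by
    rw [← Real.exp_nat_mul]; congr 1; push_cast; ring
  have hbq : Real.exp (Y / 5) ^ 2 ≤ Real.exp (Y / 2) := by
    rw [← Real.exp_nat_mul]; apply Real.exp_le_exp.mpr; push_cast; linarith
  have hEq : 16 * E ^ 2 ≤ Real.exp (Y / 2) :=
    h16.trans (hE3le.trans (Real.exp_le_exp.mpr (by linarith)))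
  have hq1 : 1 ≤ Real.exp (Y / 2) := Real.one_le_exp (by linarith)
  rw [hE2] at hR
  have hqR := abs_exp_half_log_sub_le (Real.exp_pos _) hqN hEq hR
  have hV1 : 1 ≤ Y ^ (κ / 4) := Real.one_le_rpow hY1 (by positivity)
  have hVY : Y ^ (κ / 4) ≤ Y := Real.rpow_le_self_of_one_le hY1 (by linarith)
  have hV2 : (Y ^ (κ / 4)) ^ 2 = Y ^ (κ / 2) := by
    rw [← Real.rpow_natCast, ← Real.rpow_mul hY0.le]; congr 1; push_cast; ring
  have hV2Y : Y ^ (κ / 2) ≤ Y := Real.rpow_le_self_of_one_le hY1 (by linarith)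
  have hwV : 10 * Y ^ (κ / 4) ≤ Real.exp (Y / 4) := by
    have : 1 / 4 * Y = Y / 4 := by ring
    rw [this] at h1
    linarith
  by_contra! hcard
  obtain ⟨T, hTS, hT⟩ := Set.exists_subset_encard_eq
    (show (11 : ℕ∞) ≤ _ from Order.add_one_le_of_lt hcard)
  have hTfin : T.Finite := Set.finite_of_encard_eq_coe (k := 11) hT
  lift T to Finset (ℤ × ℤ) using hTfin
  have hT11 : T.card = 11 := by
    rw [Set.encard_coe_eq_coe_finsetCard] at hT; exact_mod_cast hT
  have hpt : ∀ x ∈ T, x.1 * x.2 = (N : ℤ) ∧ 0 < x.1 ∧ 0 < x.2 ∧ 0 ≤ x.1 + x.2 - 2 * R ∧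
      ((x.1 + x.2 - 2 * R : ℤ) : ℝ) ≤ 6 * Y ^ (κ / 2) := by
    intro x hx
    obtain ⟨hx1, hx2⟩ := hTS hx
    have := divisor_pair_bounds (Real.exp_pos _) hwq hqN hV1 hwV hqR hx1 hx2
    rw [hV2] at this
    exact ⟨hx1, this⟩
  let f : ℤ × ℤ → ℕ := fun x => (x.1 + x.2 - 2 * R).toNat
  have hf : ∀ x ∈ T, ((f x : ℕ) : ℤ) = x.1 + x.2 - 2 * R := fun x hx =>
    Int.toNat_of_nonneg (hpt x hx).2.2.2.1
  have hfib : T.card ≤ 2 * (T.image f).card := by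
    refine Finset.card_le_mul_card_image T 2 fun s _ => ?_
    refine card_filter_add_eq_le_two (N := N) (c := s + 2 * R) _ ?_ ?_
    · intro x hx
      exact (hpt x (Finset.mem_filter.mp hx).1).1
    · intro x hx
      obtain ⟨hx1, hx2⟩ := Finset.mem_filter.mp hx
      have := hf x hx1
      rw [hx2] at this
      linarith
  set P := (T.image f).erase 0 with hP
  have hP5 : 5 ≤ P.card := by
    have : (T.image f).card - 1 ≤ P.card := Finset.pred_card_le_card_erase
    omega
  have hPpos : ∀ s ∈ P, 0 < s := fun s hs => Nat.pos_of_ne_zero (Finset.ne_of_mem_erase hs)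
  have hPd : ∀ s ∈ P, ∃ d : ℕ, (d : ℤ) ^ 2 = 4 * R * s + s ^ 2 - 4 * (N - R ^ 2) ∧
      Real.exp (Y / 5) ≤ d ∧ (d : ℝ) ≤ Real.exp Y ∧ (s : ℝ) ≤ 6 * Y ^ (κ / 2) := by
    intro s hs
    obtain ⟨x, hx, rfl⟩ := Finset.mem_image.mp (Finset.mem_of_mem_erase hs)
    obtain ⟨hx1, hx2, hx3, hx4, hx5⟩ := hpt x hx
    have hfx := hf x hx
    have hspos := hPpos _ hs
    rw [← hfx] at hx5
    obtain ⟨d, hd1, hd2, hd3⟩ := exists_difference_of_divisor_pair hexp hx2 hx3 hx1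
      (by rw [← hfx]; exact_mod_cast hspos) hR hEq hqR hq1 hbq
    rw [← hfx] at hd1
    exact ⟨d, hd1, hd2, hd3, by exact_mod_cast hx5⟩
  choose! d hd1 hd2 hd3 hs6 using hPd
  have hid : ∀ s ∈ P, ∀ s' ∈ P, (s : ℤ) * d s' ^ 2 - s' * d s ^ 2 =
      (s' - s) * (s * s' + 4 * (N - R ^ 2)) := by
    intro s hs s' hs'
    rw [hd1 s hs, hd1 s' hs']; ring
  have hK : ∀ s ∈ P, ∀ s' ∈ P, |(s : ℝ) * d s' ^ 2 - s' * d s ^ 2| ≤ Real.exp (3 * Y ^ κ) := by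
    intro s hs s' hs'
    have h4 : (s : ℝ) * d s' ^ 2 - s' * d s ^ 2 = (s' - s) * (s * s' + 4 * (N - R ^ 2)) := by
      exact_mod_cast hid s hs s' hs'
    have hs0 : (0 : ℝ) ≤ s := Nat.cast_nonneg _
    have hs0' : (0 : ℝ) ≤ s' := Nat.cast_nonneg _
    have hsY : (s : ℝ) ≤ 6 * Y := (hs6 s hs).trans (by linarith)
    have hsY' : (s' : ℝ) ≤ 6 * Y := (hs6 s' hs').trans (by linarith)
    have h5 : |(s' : ℝ) - s| ≤ 6 * Y := by rw [abs_le]; constructor <;> linarith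
    have h6 : |(s : ℝ) * s' + 4 * (N - R ^ 2)| ≤ 17 * E ^ 2 := by
      have h7 : (s : ℝ) * s' ≤ 36 * Y ^ 2 := by
        calc (s : ℝ) * s' ≤ (6 * Y) * (6 * Y) := by gcongr
          _ = _ := by ring
      have h8 : (0 : ℝ) ≤ s * s' := by positivity
      have h9 := abs_le.mp hR
      rw [abs_le]; constructor <;> linarith [h9.1, h9.2]
    rw [h4, abs_mul, hE3]
    calc _ ≤ 6 * Y * (17 * E ^ 2) := by gcongr
      _ = 102 * Y * E ^ 2 := by ring
      _ ≤ E * E ^ 2 := by gcongr; linarith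
      _ = E ^ 3 := by ring
  have hsqr : ∀ s ∈ P, ∀ s' ∈ P, s ≠ s' → IsSquare (s * s') →
      (s : ℤ) * s' = -4 * ((N : ℤ) - R ^ 2) := by
    intro s hs s' hs' hne hss
    refine mul_eq_of_isSquare_of_small (hPpos s hs) hne hss (hid s hs s' hs')
      (B := Real.exp (Y / 5)) ?_ (hd2 s' hs')
    have hsE : (s : ℝ) ≤ Real.exp (Y / 50) := by
      have hEE : E ^ 2 ≤ E ^ 3 := pow_le_pow_right₀ (by linarith) (by norm_num)
      have := hs6 s hs
      linarith
    calc _ ≤ Real.exp (Y / 50) * Real.exp (Y / 50) := by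
          gcongr
          exact (hK s hs s' hs').trans (by rw [hE3]; exact hE3le)
      _ = Real.exp (Y / 25) := by rw [← Real.exp_add]; ring_nf
      _ < _ := Real.exp_lt_exp.mpr (by linarith)
  obtain ⟨a, ha, b, hb, c, hc, hab, hac, hbc⟩ := exists_triple_not_isSquare_mul hP5 hPpos hsqr
  exact hq a b c (d a) (d b) (d c) (hPpos a ha) (hPpos b hb) (hPpos c hc) (hs6 a ha) (hs6 b hb)
    (hs6 c hc) hab hac hbc (hd2 a ha) (hd3 a ha) (hd2 b hb) (hd3 b hb) (hd2 c hc) (hd3 c hc)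
    (hK a ha b hb) (hK a ha c hc)

/-- For `κ = 1/2 - ε`, `0 < ε < 10⁻²`, and `N` large (depending only on `ε`)
with `|N - R²| ≤ 4·e^(2 (log N)^κ)` for some `R ∈ ℕ`, the set of factorizations
`m·n = N` with `|n - N^(1/2)| ≤ 2 N^(1/4) (log N)^(κ/4)` has at most 10 elements. -/
theorem stmt_8 (ε : ℝ) (hε0 : 0 < ε) (hε1 : ε < 1 / 100) :
    ∃ N₀ : ℕ, ∀ N : ℕ, N₀ ≤ N →
      (∃ R : ℕ, |(N : ℝ) - (R : ℝ) ^ 2| ≤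
          4 * Real.exp (2 * Real.log N ^ ((1 : ℝ) / 2 - ε))) →
      {x : ℤ × ℤ | x.1 * x.2 = (N : ℤ) ∧
          |(x.2 : ℝ) - (N : ℝ) ^ ((1 : ℝ) / 2)| ≤ 2 * (N : ℝ) ^ ((1 : ℝ) / 4) *
            Real.log N ^ (((1 : ℝ) / 2 - ε) / 4)}.encard ≤ 10 := by
  obtain ⟨Y₀, hY₀⟩ := eventually_atTop.mp (eventually_encard_divisor_pairs_le
    (show 0 < (1 : ℝ) / 2 - ε by linarith) hε0 le_rfl)
  refine ⟨⌈Real.exp Y₀⌉₊, ?_⟩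
  rintro N hN ⟨R, hR⟩
  have hN' : Real.exp Y₀ ≤ N := Nat.ceil_le.mp hN
  have hN0 : (0 : ℝ) < N := (Real.exp_pos _).trans_le hN'
  exact hY₀ (Real.log N) ((Real.le_log_iff_exp_le hN0).mpr hN') N R (by exact_mod_cast hN0) rfl hR
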